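/- arXiv:2101.00161 — 2 statements merged into one kernel-verified Lean document; each statement's English description precedes it below -/
import Mathlib

section
/- Consider the network ẋ_i = f_i(t, x_i) + k·Σ_{j∈N_i} α_{ij}(x_j − x_i) ∈ ℝ^n, i = 1,…,N, over an undirected connected weighted graph, with blended dynamics ṡ = (1/N)·Σ_{i=1}^N f_i(t, s). Assume there is a nonempty compact set 𝒜_b ⊂ ℝ^n that is uniformly asymptotically stable for the blended dynamics, with an open set 𝒟_b ⊇ 𝒜_b contained in its domain of attraction, and define 𝒟_x := {1_N ⊗ s + w : s ∈ 𝒟_b, w ∈ ℝ^{nN} with (1_Nᵀ ⊗ I_n)w = 0}. Assume in addition that 𝒜_b is locally exponentially stable for the blended dynamics and that f_i(t, s) = f_j(t, s) for all i, j ∈ {1,…,N}, all s ∈ 𝒜_b and all t. Then for every compact set K ⊂ 𝒟_x there exists k* > 0 such that for every k > k* and every initial condition (x_1(t₀),…,x_N(t₀)) ∈ K, the solution of the network exists for all t ≥ t₀ and satisfies lim_{t→∞} ‖x_i(t) − x_j(t)‖ = 0 and lim_{t→∞} dist(x_i(t), 𝒜_b) = 0 for all i, j ∈ {1,…,N}.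 -/
open Filter Matrix

/-- Euclidean norm of a finitely-indexed real vector. -/
noncomputable def eunorm {ι : Type*} [Fintype ι] (v : ι → ℝ) : ℝ :=
  Real.sqrt (∑ j, v j ^ 2)

/-- Euclidean distance from a point to a set. -/
noncomputable def einfDist {ι : Type*} [Fintype ι] (x : ι → ℝ) (A : Set (ι → ℝ)) : ℝ :=
  ⨅ a : A, eunorm (x - (a : ι → ℝ))

/-- `limsup_{t→∞} g(t) ≤ c`. -/
def LimsupLE (g : ℝ → ℝ) (c : ℝ) : Prop :=
  ∀ ε > 0, ∃ T : ℝ, ∀ t ≥ T, g t ≤ c + ε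

/-- Laplacian matrix `𝓛 = D - A` of the weighted graph with weights `α`. -/
noncomputable def lapMat {N : ℕ} (α : Fin N → Fin N → ℝ) : Matrix (Fin N) (Fin N) ℝ :=
  Matrix.of fun i j => (if i = j then ∑ l, α i l else 0) - α i j

/-- Regularity of a time-varying vector field. -/
def Reg {n : ℕ} (f : ℝ → (Fin n → ℝ) → Fin n → ℝ) : Prop :=
  Continuous (Function.uncurry f) ∧
  (∀ t, ContDiff ℝ 1 (f t)) ∧
  (∀ x₀ : Fin n → ℝ, ∃ L : NNReal, ∃ ε > 0, ∀ t, LipschitzOnWith L (f t) (Metric.ball x₀ ε)) ∧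
  (∃ C : ℝ, ∀ t, eunorm (f t 0) ≤ C)

/-- `x` is a solution of `ẋ = F(t,x)` on `[t₀,∞)`. -/
def IsSolOn {ι : Type*} [Fintype ι] (F : ℝ → (ι → ℝ) → ι → ℝ)
    (x : ℝ → ι → ℝ) (t₀ : ℝ) : Prop :=
  ∀ t ≥ t₀, HasDerivAt x (F t (x t)) t

/-- The nonempty compact set `A` is uniformly asymptotically stable for `ẋ = F(t,x)`,
with the open set `D ⊇ A` contained in its domain of attraction. -/
def UAS {ι : Type*} [Fintype ι] (F : ℝ → (ι → ℝ) → ι → ℝ)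
    (A D : Set (ι → ℝ)) : Prop :=
  (∀ ε > 0, ∃ δ > 0, ∀ (t₀ : ℝ) (x : ℝ → ι → ℝ), IsSolOn F x t₀ →
      einfDist (x t₀) A < δ → ∀ t ≥ t₀, einfDist (x t) A < ε) ∧
  (∀ C : Set (ι → ℝ), IsCompact C → C ⊆ D →
    (∀ (t₀ : ℝ), ∀ x₀ ∈ C, ∃ x : ℝ → ι → ℝ, x t₀ = x₀ ∧ IsSolOn F x t₀) ∧
    (∀ ε > 0, ∃ T > 0, ∀ (t₀ : ℝ) (x : ℝ → ι → ℝ), IsSolOn F x t₀ → x t₀ ∈ C →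
      ∀ t ≥ t₀ + T, einfDist (x t) A < ε))


/-- The nonempty compact set `A` is locally exponentially stable for `ẋ = F(t,x)`. -/
def LES {ι : Type*} [Fintype ι] (F : ℝ → (ι → ℝ) → ι → ℝ) (A : Set (ι → ℝ)) : Prop :=
  ∃ δ > (0:ℝ), ∃ c > (0:ℝ), ∃ lam > (0:ℝ), ∀ (t₀ : ℝ) (x : ℝ → ι → ℝ), IsSolOn F x t₀ →
    einfDist (x t₀) A ≤ δ →
    ∀ t ≥ t₀, einfDist (x t) A ≤ c * Real.exp (-lam * (t - t₀)) * einfDist (x t₀) A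


section Retract
variable {E : Type*} [NormedAddCommGroup E] [NormedSpace ℝ E]

/-- Radial retraction onto the closed ball of radius `R`. -/
noncomputable def rretr (R : ℝ) (x : E) : E := (R / max R ‖x‖) • x

theorem rretr_norm_le {R : ℝ} (hR : 0 < R) (x : E) : ‖rretr R x‖ ≤ R := by
  have hm : 0 < max R ‖x‖ := lt_max_of_lt_left hR
  rw [rretr, norm_smul, Real.norm_of_nonneg (by positivity), div_mul_eq_mul_div, div_le_iff₀ hm]
  exact mul_le_mul_of_nonneg_left (le_max_right _ _) hR.le

theorem rretr_norm_le_self {R : ℝ} (hR : 0 < R) (x : E) : ‖rretr R x‖ ≤ ‖x‖ := by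
  have hm : 0 < max R ‖x‖ := lt_max_of_lt_left hR
  rw [rretr, norm_smul, Real.norm_of_nonneg (by positivity)]
  have : R / max R ‖x‖ ≤ 1 := (div_le_one hm).2 (le_max_left _ _)
  nlinarith [norm_nonneg x]

theorem rretr_eq {R : ℝ} (hR : 0 < R) {x : E} (hx : ‖x‖ ≤ R) : rretr R x = x := by
  rw [rretr, max_eq_left hx, div_self hR.ne', one_smul]

theorem rretr_lip {R : ℝ} (hR : 0 < R) (x y : E) : ‖rretr R x - rretr R y‖ ≤ 2 * ‖x - y‖ := by
  have hmx : 0 < max R ‖x‖ := lt_max_of_lt_left hR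
  have hmy : 0 < max R ‖y‖ := lt_max_of_lt_left hR
  have key : rretr R x - rretr R y =
      (R / max R ‖x‖) • (x - y) + (R / max R ‖x‖ - R / max R ‖y‖) • y := by
    simp only [rretr, smul_sub, sub_smul]; abel
  have h1 : R / max R ‖x‖ ≤ 1 := (div_le_one hmx).2 (le_max_left _ _)
  have h2 : |max R ‖x‖ - max R ‖y‖| ≤ ‖x - y‖ := by
    refine (abs_max_sub_max_le_max R ‖x‖ R ‖y‖).trans ?_
    simp [abs_norm_sub_norm_le]
  have h3 : |R / max R ‖x‖ - R / max R ‖y‖| * ‖y‖ ≤ ‖x - y‖ := by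
    have : R / max R ‖x‖ - R / max R ‖y‖ =
        (R / max R ‖x‖) * ((max R ‖y‖ - max R ‖x‖) / max R ‖y‖) := by
      field_simp
    rw [this, abs_mul, abs_of_pos (div_pos hR hmx), abs_div, abs_of_pos hmy, abs_sub_comm]
    have h4 : ‖y‖ / max R ‖y‖ ≤ 1 := (div_le_one hmy).2 (le_max_right _ _)
    calc R / max R ‖x‖ * (|max R ‖x‖ - max R ‖y‖| / max R ‖y‖) * ‖y‖
        = (R / max R ‖x‖) * (|max R ‖x‖ - max R ‖y‖| * (‖y‖ / max R ‖y‖)) := by ring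
      _ ≤ 1 * (‖x - y‖ * 1) := by
          gcongr
      _ = _ := by ring
  rw [key]
  refine (norm_add_le _ _).trans ?_
  rw [norm_smul, norm_smul, Real.norm_of_nonneg (by positivity), Real.norm_eq_abs]
  nlinarith [norm_nonneg (x - y)]

end Retract

section Global
variable {E : Type*} [NormedAddCommGroup E] [NormedSpace ℝ E] [CompleteSpace E]

theorem exists_sol_Icc (G : ℝ → E → E) (L M : ℝ) (hL : 0 ≤ L) (hM : 0 ≤ M)
    (hlip : ∀ t x y, ‖G t x - G t y‖ ≤ L * ‖x - y‖) (hb : ∀ t, ‖G t 0‖ ≤ M)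
    (hc : ∀ x, Continuous fun t => G t x) (t₀ T : ℝ) (hT : 0 ≤ T) (X₀ : E) :
    ∃ y : ℝ → E, y t₀ = X₀ ∧ ∀ t ∈ Set.Icc t₀ (t₀ + T),
      HasDerivWithinAt y (G t (y t)) (Set.Icc t₀ (t₀ + T)) t := by
  have hgrow : ∀ t x, ‖G t x‖ ≤ L * ‖x‖ + M := by
    intro t x
    have h1 := hlip t x 0
    have h2 := norm_add_le (G t x - G t 0) (G t 0)
    simp only [sub_add_cancel, sub_zero] at h1 h2
    linarith [hb t]
  set ρ : ℝ := gronwallBound ‖X₀‖ L M T + 1 with hρ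
  have hρ0 : 0 < ρ := by
    have := gronwallBound_mono (norm_nonneg X₀) hM hL hT
    rw [gronwallBound_x0] at this
    have := norm_nonneg X₀
    linarith
  set B : ℝ := L * ρ + M with hB
  have hB0 : 0 ≤ B := by positivity
  have hpl : IsPicardLindelof (fun t x => G t (rretr ρ x)) (tmin := t₀) (tmax := t₀ + T)
      ⟨t₀, by simp [hT]⟩ X₀ ⟨B * T, by positivity⟩ 0 ⟨B, hB0⟩ ⟨L * 2, by positivity⟩ := by
    refine ⟨?_, ?_, ?_, ?_⟩
    · intro t _
      apply LipschitzWith.lipschitzOnWith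
      apply LipschitzWith.of_dist_le_mul
      intro x y
      rw [dist_eq_norm, dist_eq_norm]
      refine (hlip t _ _).trans ?_
      have := rretr_lip hρ0 x y
      change _ ≤ L * 2 * ‖x - y‖
      nlinarith
    · intro x _
      exact (hc _).continuousOn
    · intro t _ x _
      refine (hgrow t _).trans ?_
      have := rretr_norm_le hρ0 x
      change _ ≤ B
      nlinarith
    · simp [hT]
      rfl
  obtain ⟨y, hy0, hy⟩ := hpl.exists_eq_forall_mem_Icc_hasDerivWithinAt₀
  refine ⟨y, hy0, ?_⟩
  have hbound : ∀ t ∈ Set.Icc t₀ (t₀ + T), ‖y t‖ ≤ gronwallBound ‖X₀‖ L M (t - t₀) := by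
    refine norm_le_gronwallBound_of_norm_deriv_right_le (f' := fun t => G t (rretr ρ (y t)))
      (fun t ht => (hy t ht).continuousWithinAt) ?_ ?_ ?_
    · intro t ht
      exact (hy t ⟨ht.1, ht.2.le⟩).mono_of_mem_nhdsWithin (Icc_mem_nhdsGE_of_mem ht)
    · exact le_of_eq (by rw [← hy0])
    · intro t ht
      refine (hgrow t _).trans ?_
      have := rretr_norm_le_self hρ0 (y t)
      nlinarith
  intro t ht
  have h1 : ‖y t‖ ≤ ρ := by
    have := gronwallBound_mono (norm_nonneg X₀) hM hL (show t - t₀ ≤ T by linarith [ht.2])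
    linarith [hbound t ht]
  have := hy t ht
  simpa only [rretr_eq hρ0 h1] using this

theorem exists_sol_global (G : ℝ → E → E) (L M : ℝ) (hL : 0 ≤ L) (hM : 0 ≤ M)
    (hlip : ∀ t x y, ‖G t x - G t y‖ ≤ L * ‖x - y‖) (hb : ∀ t, ‖G t 0‖ ≤ M)
    (hc : ∀ x, Continuous fun t => G t x) (t₀ : ℝ) (X₀ : E) :
    ∃ y : ℝ → E, y t₀ = X₀ ∧ ∀ t ≥ t₀, HasDerivAt y (G t (y t)) t := by
  have hex : ∀ n : ℕ, ∃ y : ℝ → E, y t₀ = X₀ ∧ ∀ t ∈ Set.Icc t₀ (t₀ + (n + 1 : ℝ)),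
      HasDerivWithinAt y (G t (y t)) (Set.Icc t₀ (t₀ + (n + 1 : ℝ))) t := fun n =>
    exists_sol_Icc G L M hL hM hlip hb hc t₀ (n + 1) (by positivity) X₀
  choose β hβ0 hβ using hex
  have huniq : ∀ n m : ℕ, n ≤ m → ∀ t ∈ Set.Icc t₀ (t₀ + (n + 1 : ℝ)), β n t = β m t := by
    intro n m hnm
    have hnm' : (n : ℝ) ≤ m := by exact_mod_cast hnm
    have hsub : Set.Icc t₀ (t₀ + (n + 1 : ℝ)) ⊆ Set.Icc t₀ (t₀ + (m + 1 : ℝ)) :=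
      Set.Icc_subset_Icc le_rfl (by linarith)
    refine ODE_solution_unique (v := G) (K := ⟨L, hL⟩) ?_
      (fun t ht => (hβ n t ht).continuousWithinAt) ?_
      (fun t ht => ((hβ m t (hsub ht)).mono hsub).continuousWithinAt) ?_ (by rw [hβ0, hβ0])
    · intro t
      apply LipschitzWith.of_dist_le_mul
      intro x y
      rw [dist_eq_norm, dist_eq_norm]
      exact hlip t x y
    · intro t ht
      exact (hβ n t ⟨ht.1, ht.2.le⟩).mono_of_mem_nhdsWithin (Icc_mem_nhdsGE_of_mem ht)
    · intro t ht
      exact ((hβ m t (hsub ⟨ht.1, ht.2.le⟩)).mono hsub).mono_of_mem_nhdsWithin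
        (Icc_mem_nhdsGE_of_mem ht)
  have hmem : ∀ t, t₀ ≤ t → t ∈ Set.Icc t₀ (t₀ + ((⌈t - t₀⌉₊ : ℕ) + 1 : ℝ)) := by
    intro t ht
    have := Nat.le_ceil (t - t₀)
    exact ⟨ht, by linarith⟩
  set y : ℝ → E := fun t => if t₀ ≤ t then β ⌈t - t₀⌉₊ t else X₀ + (t - t₀) • G t₀ X₀ with hy
  have hyβ : ∀ n : ℕ, ∀ t ∈ Set.Icc t₀ (t₀ + (n + 1 : ℝ)), y t = β n t := by
    intro n t ht
    simp only [hy, if_pos ht.1]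
    rcases le_total n ⌈t - t₀⌉₊ with h | h
    · exact (huniq _ _ h t ht).symm
    · exact huniq _ _ h t (hmem t ht.1)
  have hy0 : y t₀ = X₀ := by
    simp only [hy, le_refl, if_true, hβ0]
  have hright : ∀ t ≥ t₀, HasDerivWithinAt y (G t (y t)) (Set.Ici t₀) t := by
    intro t ht
    have hm := hmem t ht
    set n := ⌈t - t₀⌉₊
    have hlt : t < t₀ + (n + 1 : ℝ) := by
      have := Nat.le_ceil (t - t₀)
      change t - t₀ ≤ (n : ℝ) at this
      linarith
    have h1 : HasDerivWithinAt y (G t (y t)) (Set.Icc t₀ (t₀ + (n + 1 : ℝ))) t := by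
      rw [hyβ n t hm]
      exact (hβ n t hm).congr (fun z hz => hyβ n z hz) (hyβ n t hm)
    refine h1.mono_of_mem_nhdsWithin ?_
    have : Set.Ici t₀ ∩ Set.Iio (t₀ + (n + 1 : ℝ)) ∈ nhdsWithin t (Set.Ici t₀) :=
      inter_mem self_mem_nhdsWithin (mem_nhdsWithin_of_mem_nhds (Iio_mem_nhds hlt))
    exact mem_of_superset this fun z hz => ⟨hz.1, le_of_lt hz.2⟩
  refine ⟨y, hy0, fun t ht => ?_⟩
  rcases eq_or_lt_of_le ht with h | h
  · subst h
    have hleft : HasDerivWithinAt y (G t₀ (y t₀)) (Set.Iic t₀) t₀ := by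
      rw [hy0]
      have h2 : HasDerivAt (fun t => X₀ + (t - t₀) • G t₀ X₀) (G t₀ X₀) t₀ := by
        simpa using (((hasDerivAt_id t₀).sub_const t₀).smul_const (G t₀ X₀)).const_add X₀
      refine h2.hasDerivWithinAt.congr ?_ ?_
      · intro z hz
        rcases eq_or_lt_of_le (show z ≤ t₀ from hz) with h | h
        · subst h; simp [hy0]
        · simp only [hy, if_neg (not_le.2 h)]
      · simp [hy0]
    have := hleft.union (hright t₀ le_rfl)
    rwa [Set.Iic_union_Ici, hasDerivWithinAt_univ] at this
  · exact (hright t ht).hasDerivAt (Ici_mem_nhds h)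

end Global


section Scalar

theorem scalar_gron {g : ℝ → ℝ} {a T K ε : ℝ}
    (hg : ∀ t ∈ Set.Icc a (a + T), ∃ g', HasDerivAt g g' t ∧ g' ≤ K * g t + ε) :
    ∀ t ∈ Set.Icc a (a + T), g t ≤ gronwallBound (g a) K ε (t - a) := by
  refine le_gronwallBound_of_liminf_deriv_right_le (f' := deriv g) ?_ ?_ le_rfl ?_
  · intro t ht
    obtain ⟨g', h, _⟩ := hg t ht
    exact h.continuousAt.continuousWithinAt
  · intro t ht r hr
    obtain ⟨g', h, _⟩ := hg t ⟨ht.1, ht.2.le⟩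
    rw [h.deriv] at hr
    exact (h.hasDerivWithinAt (s := Set.Ici t)).liminf_right_slope_le hr
  · intro t ht
    obtain ⟨g', h, h'⟩ := hg t ⟨ht.1, ht.2.le⟩
    rwa [h.deriv]

theorem gron_pos {δ K ε x : ℝ} (hK : 0 ≤ K) (hε : 0 ≤ ε) :
    gronwallBound δ K ε x ≤ Real.exp (K * x) * (δ + ε * x) := by
  rcases eq_or_lt_of_le hK with h | h
  · subst h
    simp [gronwallBound_K0]
  · rw [gronwallBound_of_K_ne_0 h.ne']
    have h1 : 1 - K * x ≤ Real.exp (-(K * x)) := by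
      have := Real.add_one_le_exp (-(K * x)); linarith
    have h2 : Real.exp (K * x) - 1 ≤ K * x * Real.exp (K * x) := by
      have h3 := mul_le_mul_of_nonneg_left h1 (Real.exp_pos (K * x)).le
      rw [← Real.exp_add] at h3
      simp at h3
      linarith
    have h4 : ε / K * (Real.exp (K * x) - 1) ≤ ε / K * (K * x * Real.exp (K * x)) :=
      mul_le_mul_of_nonneg_left h2 (by positivity)
    have h5 : ε / K * (K * x * Real.exp (K * x)) = Real.exp (K * x) * (ε * x) := by
      field_simp
    simp only
    linarith

theorem gron_neg {δ κ ε x : ℝ} (hκ : 0 < κ) (hε : 0 ≤ ε) :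
    gronwallBound δ (-κ) ε x ≤ Real.exp (-κ * x) * δ + ε / κ := by
  rw [gronwallBound_of_K_ne_0 (by linarith)]
  have h1 : ε / -κ * (Real.exp (-κ * x) - 1) = ε / κ * (1 - Real.exp (-κ * x)) := by
    rw [div_neg]; ring
  simp only [h1]
  have h2 : ε / κ * (1 - Real.exp (-κ * x)) ≤ ε / κ * 1 :=
    mul_le_mul_of_nonneg_left (by linarith [Real.exp_pos (-κ * x)]) (by positivity)
  linarith

theorem scalar_cmp {U V : ℝ → ℝ} {a T L κ P Q m : ℝ} (hT : 0 ≤ T) (hL : 0 ≤ L) (hκ : 1 ≤ κ)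
    (hP : 0 ≤ P) (hQ : 0 ≤ Q) (hm : 0 ≤ m) (hU0 : ∀ t, 0 ≤ U t) (hV0 : ∀ t, 0 ≤ V t)
    (hU : ∀ t ∈ Set.Icc a (a + T), ∃ U', HasDerivAt U U' t ∧ U' ≤ 3 * L * U t + L * V t)
    (hV : ∀ t ∈ Set.Icc a (a + T), ∃ V', HasDerivAt V V' t ∧
      V' ≤ -κ * V t + m / κ * (P + Q * U t)) :
    ∀ t ∈ Set.Icc a (a + T),
      U t ≤ Real.exp ((3 * L + L * m * Q) * T) * (1 + L + T * L * m) * (U a + (V a + P) / κ) ∧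
      V t ≤ Real.exp (-κ * (t - a)) * V a + m / κ * (P + Q *
        (Real.exp ((3 * L + L * m * Q) * T) * (1 + L + T * L * m) * (U a + (V a + P) / κ))) := by
  have hκ0 : 0 < κ := by linarith
  set p := 3 * L + L * m * Q with hp
  have hp0 : 0 ≤ p := by positivity
  have hUb : ∀ t ∈ Set.Icc a (a + T),
      U t ≤ Real.exp (p * T) * (1 + L + T * L * m) * (U a + (V a + P) / κ) := by
    intro t ht
    have hW : ∀ t ∈ Set.Icc a (a + T), ∃ W', HasDerivAt (fun t => U t + L / κ * V t) W' t ∧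
        W' ≤ p * (U t + L / κ * V t) + L * m / κ * P := by
      intro t ht
      obtain ⟨U', hU1, hU2⟩ := hU t ht
      obtain ⟨V', hV1, hV2⟩ := hV t ht
      refine ⟨U' + L / κ * V', hU1.add (hV1.const_mul _), ?_⟩
      have h1 : L / κ * V' ≤ L / κ * (-κ * V t + m / κ * (P + Q * U t)) :=
        mul_le_mul_of_nonneg_left hV2 (by positivity)
      have h2 : L / κ * (-κ * V t + m / κ * (P + Q * U t)) =
        - L * V t + L * m / κ * (P + Q * U t) * (1 / κ) := by field_simp
      have h3 : L * m / κ * (P + Q * U t) * (1 / κ) ≤ L * m / κ * P + L * m * Q * U t := by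
        have hi : 1 / κ ≤ 1 := (div_le_one hκ0).2 hκ
        have hUt := hU0 t
        have e1 : L * m / κ * (P + Q * U t) * (1 / κ) ≤ L * m / κ * (P + Q * U t) * 1 :=
          mul_le_mul_of_nonneg_left hi (by positivity)
        have e2 : L * m / κ * (Q * U t) ≤ L * m * (Q * U t) :=
          mul_le_mul_of_nonneg_right (div_le_self (by positivity) hκ) (by positivity)
        linarith
      have h4 : 0 ≤ p * (L / κ * V t) := by have := hV0 t; positivity
      have h5 : p * U t = 3 * L * U t + L * m * Q * U t := by rw [hp]; ring
      nlinarith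
    have h1 := scalar_gron hW t ht
    have h2 := gron_pos (δ := U a + L / κ * V a) (x := t - a) hp0
      (show 0 ≤ L * m / κ * P by positivity)
    have hVt := hV0 t
    have hVa := hV0 a
    have hUa := hU0 a
    have h3 : 0 ≤ L / κ * V t := by positivity
    have hta : 0 ≤ t - a := by linarith [ht.1]
    have htT : t - a ≤ T := by linarith [ht.2]
    have h4 : Real.exp (p * (t - a)) * (U a + L / κ * V a + L * m / κ * P * (t - a)) ≤
        Real.exp (p * T) * ((1 + L + T * L * m) * (U a + (V a + P) / κ)) := by
      apply mul_le_mul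
      · exact Real.exp_le_exp.2 (mul_le_mul_of_nonneg_left htT hp0)
      · have e1 : L * m / κ * P * (t - a) ≤ L * m / κ * P * T :=
          mul_le_mul_of_nonneg_left htT (by positivity)
        have e2 : (1 + L + T * L * m) * (U a + (V a + P) / κ) =
          U a + L / κ * V a + L * m / κ * P * T + (L + T * L * m) * U a
            + ((1 + T * L * m) * V a + (1 + L) * P) / κ := by ring
        have e3 : 0 ≤ (L + T * L * m) * U a := by positivity
        have e4 : 0 ≤ ((1 + T * L * m) * V a + (1 + L) * P) / κ := by positivity
        linarith
      · positivity
      · positivity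
    linarith
  intro t ht
  refine ⟨hUb t ht, ?_⟩
  set Ub := Real.exp (p * T) * (1 + L + T * L * m) * (U a + (V a + P) / κ) with hUbdef
  have hUb0 : 0 ≤ Ub := by
    have hVa := hV0 a
    have hUa := hU0 a
    positivity
  have hV' : ∀ t ∈ Set.Icc a (a + T), ∃ V', HasDerivAt V V' t ∧
      V' ≤ -κ * V t + m / κ * (P + Q * Ub) := by
    intro t ht
    obtain ⟨V', h1, h2⟩ := hV t ht
    refine ⟨V', h1, h2.trans ?_⟩
    have := hUb t ht
    gcongr
  have h1 := scalar_gron hV' t ht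
  have h2 := gron_neg (δ := V a) (x := t - a) hκ0 (show 0 ≤ m / κ * (P + Q * Ub) by positivity)
  have h3 : m / κ * (P + Q * Ub) / κ ≤ m / κ * (P + Q * Ub) := div_le_self (by positivity) hκ
  linarith
end Scalar

section Net
variable {E : Type*} [NormedAddCommGroup E] [InnerProductSpace ℝ E] {N : ℕ}

/-- mean -/
noncomputable def nmean (X : Fin N → E) : E := (N : ℝ)⁻¹ • ∑ i, X i

/-- squared disagreement -/
noncomputable def ndis (X : Fin N → E) : ℝ := ∑ i, ‖X i - nmean X‖ ^ 2

theorem ndis_nonneg (X : Fin N → E) : 0 ≤ ndis X := Finset.sum_nonneg fun _ _ => by positivity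

theorem sum_dev (hN : 0 < N) (X : Fin N → E) : ∑ i, (X i - nmean X) = 0 := by
  have : (N : ℝ) ≠ 0 := by positivity
  rw [Finset.sum_sub_distrib, Finset.sum_const, Finset.card_univ, Fintype.card_fin,
    ← Nat.cast_smul_eq_nsmul ℝ, nmean, smul_smul, mul_inv_cancel₀ this, one_smul, sub_self]

theorem coupling_sum (α : Fin N → Fin N → ℝ) (hsym : ∀ i j, α i j = α j i) (X : Fin N → E) :
    ∑ i, ∑ j, α i j • (X j - X i) = 0 := by
  have h : ∑ i, ∑ j, α i j • (X j - X i) = -∑ i, ∑ j, α i j • (X j - X i) := by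
    conv_lhs => rw [Finset.sum_comm]
    rw [← Finset.sum_neg_distrib]
    refine Finset.sum_congr rfl fun i _ => ?_
    rw [← Finset.sum_neg_distrib]
    refine Finset.sum_congr rfl fun j _ => ?_
    rw [hsym j i, ← smul_neg, neg_sub]
  have h2 : (2 : ℝ) • ∑ i, ∑ j, α i j • (X j - X i) = 0 := by
    rw [two_smul]; nth_rewrite 1 [h]; simp
  simpa using h2

theorem nmean_deriv {α : Fin N → Fin N → ℝ} (hsym : ∀ i j, α i j = α j i) {k t : ℝ}
    {x : Fin N → ℝ → E} {v : Fin N → E}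
    (hx : ∀ i, HasDerivAt (x i) (v i + k • ∑ j, α i j • (x j t - x i t)) t) :
    HasDerivAt (fun t => nmean fun i => x i t) (nmean v) t := by
  have h1 : HasDerivAt (fun t => nmean fun i => x i t)
      ((N : ℝ)⁻¹ • ∑ i, (v i + k • ∑ j, α i j • (x j t - x i t))) t := by
    unfold nmean
    exact (HasDerivAt.fun_sum fun i _ => hx i).const_smul _
  rw [Finset.sum_add_distrib, ← Finset.smul_sum, coupling_sum α hsym (fun i => x i t), smul_zero,
    add_zero] at h1
  exact h1

theorem U_deriv (hN : 0 < N) {g : Fin N → E → E} {L : ℝ} (hL : 0 ≤ L)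
    (hlip : ∀ i x y, ‖g i x - g i y‖ ≤ L * ‖x - y‖) {t : ℝ}
    {X : Fin N → E} {s φ : ℝ → E} (hsX : s t = nmean X)
    (hs : HasDerivAt s (nmean fun i => g i (X i)) t)
    (hφ : HasDerivAt φ (nmean fun i => g i (φ t)) t) :
    ∃ U', HasDerivAt (fun t => ‖s t - φ t‖ ^ 2) U' t ∧
      U' ≤ 3 * L * ‖s t - φ t‖ ^ 2 + L * ndis X := by
  refine ⟨_, (hs.sub hφ).norm_sq, ?_⟩
  have hN1 : (1 : ℝ) ≤ N := by exact_mod_cast hN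
  set u := ‖s t - φ t‖ with hu
  have hu0 : 0 ≤ u := norm_nonneg _
  have h1 : ‖(nmean fun i => g i (X i)) - nmean fun i => g i (φ t)‖ ≤
      (N : ℝ)⁻¹ * ∑ i, L * (‖X i - nmean X‖ + u) := by
    unfold nmean
    rw [← smul_sub, ← Finset.sum_sub_distrib, norm_smul, Real.norm_of_nonneg (by positivity)]
    gcongr
    refine norm_sum_le_of_le _ fun i _ => (hlip i _ _).trans ?_
    gcongr
    have := norm_add_le (X i - nmean X) (s t - φ t)
    rw [hsX, sub_add_sub_cancel] at this
    rw [hu, hsX]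
    exact this
  have h2 := real_inner_le_norm (s t - φ t)
    ((nmean fun i => g i (X i)) - nmean fun i => g i (φ t))
  have h3 : u * ((N : ℝ)⁻¹ * ∑ i, L * (‖X i - nmean X‖ + u)) * 2 ≤
      (N : ℝ)⁻¹ * ∑ i, L * (‖X i - nmean X‖ ^ 2 + 3 * u ^ 2) := by
    have : u * ((N : ℝ)⁻¹ * ∑ i, L * (‖X i - nmean X‖ + u)) * 2 =
        (N : ℝ)⁻¹ * ∑ i, L * (2 * u * ‖X i - nmean X‖ + 2 * u ^ 2) := by
      rw [mul_left_comm, Finset.mul_sum, mul_assoc, Finset.sum_mul]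
      congr 1
      refine Finset.sum_congr rfl fun i _ => ?_
      ring
    rw [this]
    refine mul_le_mul_of_nonneg_left
      (Finset.sum_le_sum fun i _ => mul_le_mul_of_nonneg_left ?_ hL) (by positivity)
    nlinarith [sq_nonneg (u - ‖X i - nmean X‖)]
  have h4 : (N : ℝ)⁻¹ * ∑ i : Fin N, L * (‖X i - nmean X‖ ^ 2 + 3 * u ^ 2) =
      (N : ℝ)⁻¹ * (L * ndis X) + 3 * L * u ^ 2 := by
    rw [← Finset.mul_sum, Finset.sum_add_distrib, Finset.sum_const, Finset.card_univ,
      Fintype.card_fin, nsmul_eq_mul, ndis]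
    field_simp
  have h5 : (N : ℝ)⁻¹ * (L * ndis X) ≤ 1 * (L * ndis X) := by
    have := ndis_nonneg X
    have := inv_le_one_of_one_le₀ hN1
    gcongr
  have h6 := mul_le_mul_of_nonneg_left h1 hu0
  change 2 * inner ℝ (s t - φ t) _ ≤ _
  rw [← hu] at h2
  linarith

theorem V_deriv (hN : 0 < N) {g : Fin N → E → E} {L lam k κ ρ : ℝ}
    (hlip : ∀ i x y, ‖g i x - g i y‖ ≤ L * ‖x - y‖) {α : Fin N → Fin N → ℝ}
    (hdis : ∀ e : Fin N → E, ∑ i, e i = 0 →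
      ∑ i, inner ℝ (e i) (∑ j, α i j • (e j - e i)) ≤ -lam * ∑ i, ‖e i‖ ^ 2)
    (hsym : ∀ i j, α i j = α j i) {t : ℝ} (hκ : 0 < κ) (hk : 0 ≤ k) (hkκ : κ + L ≤ k * lam)
    {x : Fin N → ℝ → E} {p : E}
    (hx : ∀ i, HasDerivAt (x i) (g i (x i t) + k • ∑ j, α i j • (x j t - x i t)) t)
    (hp : ∀ i, ‖g i (nmean fun j => x j t) - p‖ ≤ ρ) :
    ∃ V', HasDerivAt (fun t => ndis fun i => x i t) V' t ∧
      V' ≤ -κ * (ndis fun i => x i t) + N / κ * ρ ^ 2 := by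
  have hs := nmean_deriv hsym hx
  set s : ℝ → E := fun t => nmean fun i => x i t with hsdef
  set sd : E := nmean fun i => g i (x i t) with hsd
  have hV : HasDerivAt (fun t => ndis fun i => x i t)
      (∑ i, 2 * inner ℝ (x i t - s t)
        (g i (x i t) + k • ∑ j, α i j • (x j t - x i t) - sd)) t := by
    unfold ndis
    exact HasDerivAt.fun_sum fun i _ => ((hx i).sub hs).norm_sq
  refine ⟨_, hV, ?_⟩
  set e : Fin N → E := fun i => x i t - s t with he
  have hsum : ∑ i, e i = 0 := sum_dev hN (fun i => x i t)
  have hinner : ∀ q : E, ∑ i, inner ℝ (e i) q = 0 := by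
    intro q
    rw [← sum_inner, hsum, inner_zero_left]
  have hdd := hdis e hsum
  have hee : ∀ i j, e j - e i = x j t - x i t := fun i j => by simp [he]
  simp only [hee] at hdd
  have hsplit : ∑ i, 2 * inner ℝ (x i t - s t)
        (g i (x i t) + k • ∑ j, α i j • (x j t - x i t) - sd) =
      2 * ∑ i, inner ℝ (e i) (g i (x i t) - p) +
        2 * k * ∑ i, inner ℝ (e i) (∑ j, α i j • (x j t - x i t)) := by
    have h1 : ∀ i, 2 * inner ℝ (x i t - s t)
        (g i (x i t) + k • ∑ j, α i j • (x j t - x i t) - sd) =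
        2 * inner ℝ (e i) (g i (x i t) - p)
        + 2 * k * inner ℝ (e i) (∑ j, α i j • (x j t - x i t)) + 2 * inner ℝ (e i) (p - sd) := by
      intro i
      simp only [inner_sub_right, inner_add_right, inner_smul_right, he]
      ring
    simp only [h1, Finset.sum_add_distrib, ← Finset.mul_sum, hinner]
    ring
  rw [hsplit]
  have hndis : (ndis fun i => x i t) = ∑ i, ‖e i‖ ^ 2 := rfl
  have h2 : 2 * ∑ i, inner ℝ (e i) (g i (x i t) - p) ≤
      ∑ i, ((2 * L + κ) * ‖e i‖ ^ 2 + ρ ^ 2 / κ) := by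
    rw [Finset.mul_sum]
    refine Finset.sum_le_sum fun i _ => ?_
    have a1 := real_inner_le_norm (e i) (g i (x i t) - p)
    have a2 : ‖g i (x i t) - p‖ ≤ L * ‖e i‖ + ρ := by
      have b1 := norm_add_le (g i (x i t) - g i (s t)) (g i (s t) - p)
      rw [sub_add_sub_cancel] at b1
      exact b1.trans (add_le_add (hlip i _ _) (hp i))
    have a3 := mul_le_mul_of_nonneg_left a2 (norm_nonneg (e i))
    have a4 : 2 * ‖e i‖ * ρ ≤ κ * ‖e i‖ ^ 2 + ρ ^ 2 / κ := by
      have : κ * ‖e i‖ ^ 2 + ρ ^ 2 / κ - 2 * ‖e i‖ * ρ = (κ * ‖e i‖ - ρ) ^ 2 / κ := by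
        field_simp; ring
      have : 0 ≤ (κ * ‖e i‖ - ρ) ^ 2 / κ := by positivity
      linarith
    nlinarith
  rw [Finset.sum_add_distrib, ← Finset.mul_sum, Finset.sum_const, Finset.card_univ,
    Fintype.card_fin, nsmul_eq_mul, ← hndis] at h2
  rw [← hndis] at hdd
  have h3 := mul_le_mul_of_nonneg_left hdd (show 0 ≤ 2 * k by positivity)
  have h4 := ndis_nonneg fun i => x i t
  have h5 := mul_le_mul_of_nonneg_right hkκ h4
  have h6 : (N : ℝ) * (ρ ^ 2 / κ) = N / κ * ρ ^ 2 := by ring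
  nlinarith

end Net


section Phases
variable {E : Type*} [NormedAddCommGroup E] [InnerProductSpace ℝ E] {N : ℕ}

theorem interval_est (hN : 0 < N) {g : Fin N → ℝ → E → E} {L lam : ℝ} (hL : 0 ≤ L)
    (hlip : ∀ i t x y, ‖g i t x - g i t y‖ ≤ L * ‖x - y‖) {α : Fin N → Fin N → ℝ}
    (hdis : ∀ e : Fin N → E, ∑ i, e i = 0 →
      ∑ i, inner ℝ (e i) (∑ j, α i j • (e j - e i)) ≤ -lam * ∑ i, ‖e i‖ ^ 2)
    (hsym : ∀ i j, α i j = α j i) {k κ : ℝ} (hκ : 1 ≤ κ) (hk : 0 ≤ k) (hkκ : κ + L ≤ k * lam)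
    {x : Fin N → ℝ → E} {a T : ℝ} (hT : 0 ≤ T)
    (hx : ∀ i, ∀ t ≥ a, HasDerivAt (x i) (g i t (x i t) + k • ∑ j, α i j • (x j t - x i t)) t)
    {φ : ℝ → E} (hφ : ∀ t ≥ a, HasDerivAt φ (nmean fun i => g i t (φ t)) t)
    {P Q : ℝ} (hP : 0 ≤ P) (hQ : 0 ≤ Q)
    (hρ : ∀ t ∈ Set.Icc a (a + T), ∃ (p : E) (ρ : ℝ),
      (∀ i, ‖g i t (nmean fun j => x j t) - p‖ ≤ ρ) ∧
      ρ ^ 2 ≤ P + Q * ‖(nmean fun j => x j t) - φ t‖ ^ 2) :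
    ∀ t ∈ Set.Icc a (a + T),
      ‖(nmean fun j => x j t) - φ t‖ ^ 2 ≤
        Real.exp ((3 * L + L * N * Q) * T) * (1 + L + T * L * N) *
          (‖(nmean fun j => x j a) - φ a‖ ^ 2 + ((ndis fun j => x j a) + P) / κ) ∧
      (ndis fun j => x j t) ≤ Real.exp (-κ * (t - a)) * (ndis fun j => x j a) + N / κ * (P + Q *
        (Real.exp ((3 * L + L * N * Q) * T) * (1 + L + T * L * N) *
          (‖(nmean fun j => x j a) - φ a‖ ^ 2 + ((ndis fun j => x j a) + P) / κ))) := by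
  have hκ0 : 0 < κ := by linarith
  refine scalar_cmp (U := fun t => ‖(nmean fun j => x j t) - φ t‖ ^ 2)
    (V := fun t => ndis fun j => x j t) hT hL hκ hP hQ (Nat.cast_nonneg N)
    (fun t => by positivity) (fun t => ndis_nonneg _) ?_ ?_
  · intro t ht
    exact U_deriv hN (g := fun i => g i t) hL (fun i => hlip i t) (X := fun j => x j t) rfl
      (nmean_deriv hsym fun i => hx i t ht.1) (hφ t ht.1)
  · intro t ht
    obtain ⟨p, ρ, h1, h2⟩ := hρ t ht
    obtain ⟨V', hV1, hV2⟩ := V_deriv hN (g := fun i => g i t) (fun i => hlip i t) hdis hsym hκ0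
      hk hkκ (fun i => hx i t ht.1) h1
    refine ⟨V', hV1, hV2.trans ?_⟩
    gcongr

theorem exp_neg_le_inv {κ T : ℝ} (hκ : 0 < κ) (hT : 0 < T) :
    Real.exp (-κ * T) ≤ T⁻¹ / κ := by
  have h : 0 < κ * T := by positivity
  have h1 := Real.add_one_le_exp (κ * T)
  rw [neg_mul, Real.exp_neg]
  have : T⁻¹ / κ = (κ * T)⁻¹ := by field_simp
  rw [this]
  gcongr
  linarith

theorem phase2_step (hN : 0 < N) {g : Fin N → ℝ → E → E} {L lam : ℝ} (hL : 0 ≤ L)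
    (hlip : ∀ i t x y, ‖g i t x - g i t y‖ ≤ L * ‖x - y‖) {α : Fin N → Fin N → ℝ}
    (hdis : ∀ e : Fin N → E, ∑ i, e i = 0 →
      ∑ i, inner ℝ (e i) (∑ j, α i j • (e j - e i)) ≤ -lam * ∑ i, ‖e i‖ ^ 2)
    (hsym : ∀ i j, α i j = α j i) {A : Set E} (hA : A.Nonempty) (hAc : IsCompact A)
    (hagree : ∀ (i j : Fin N) (t : ℝ), ∀ s ∈ A, g i t s = g j t s)
    {c T : ℝ} (hc : 0 < c) (hT : 0 < T) :
    ∃ Kc ≥ (1 : ℝ), ∀ (k κ : ℝ), Kc ≤ κ → 0 ≤ k → κ + L ≤ k * lam →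
      ∀ (x : Fin N → ℝ → E) (a : ℝ),
      (∀ i, ∀ t ≥ a, HasDerivAt (x i) (g i t (x i t) + k • ∑ j, α i j • (x j t - x i t)) t) →
      ∀ φ : ℝ → E, φ a = (nmean fun j => x j a) →
      (∀ t ≥ a, HasDerivAt φ (nmean fun i => g i t (φ t)) t) →
      (∀ t ≥ a, Metric.infDist (φ t) A ≤ c * Metric.infDist (nmean fun j => x j a) A) →
      Metric.infDist (φ (a + T)) A ≤ 1 / 4 * Metric.infDist (nmean fun j => x j a) A →
      (Metric.infDist (nmean fun j => x j (a + T)) A ^ 2 + (ndis fun j => x j (a + T)) ≤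
        1 / 2 * (Metric.infDist (nmean fun j => x j a) A ^ 2 + (ndis fun j => x j a))) ∧
      ∀ t ∈ Set.Icc a (a + T),
        Metric.infDist (nmean fun j => x j t) A ^ 2 ≤
          (2 * c ^ 2 + 2) * (Metric.infDist (nmean fun j => x j a) A ^ 2 + (ndis fun j => x j a)) ∧
        (ndis fun j => x j t) ≤
          2 * (Metric.infDist (nmean fun j => x j a) A ^ 2 + (ndis fun j => x j a)) := by
  set C1 := Real.exp ((3 * L + L * N * (2 * L ^ 2)) * T) * (1 + L + T * L * N) with hC1
  have hC10 : 0 ≤ C1 := by positivity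
  set C2 := C1 * (1 + 2 * L ^ 2 * c ^ 2) with hC2
  have hC20 : 0 ≤ C2 := by positivity
  set C3 := N * (2 * L ^ 2 * c ^ 2 + 2 * L ^ 2 * C2) with hC3
  have hC30 : 0 ≤ C3 := by positivity
  clear_value C1 C2 C3
  have hTi : 0 < T⁻¹ := by positivity
  refine ⟨1 + C2 + C3 + 4 * (2 * C2 + T⁻¹ + C3), by linarith, ?_⟩
  intro k κ hκ hk hkκ x a hx φ hφ0 hφ hφA hφT
  have hκ1 : 1 ≤ κ := by linarith
  have hκ0 : 0 < κ := by linarith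
  set a0 := Metric.infDist (nmean fun j => x j a) A with ha0
  have ha00 : 0 ≤ a0 := Metric.infDist_nonneg
  set V0 := ndis fun j => x j a with hV0
  have hV00 : 0 ≤ V0 := ndis_nonneg _
  set S := a0 ^ 2 + V0 with hS
  have hS0 : 0 ≤ S := by positivity
  clear_value S V0 a0
  have htri : ∀ t, Metric.infDist (nmean fun j => x j t) A ≤
      Metric.infDist (φ t) A + ‖(nmean fun j => x j t) - φ t‖ := by
    intro t
    rw [← dist_eq_norm]
    exact Metric.infDist_le_infDist_add_dist
  have hest := interval_est hN hL hlip hdis hsym hκ1 hk hkκ hT.le hx hφ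
    (P := 2 * L ^ 2 * c ^ 2 * a0 ^ 2) (Q := 2 * L ^ 2) (by positivity) (by positivity) (by
      intro t ht
      obtain ⟨z, hzA, hz⟩ := hAc.exists_infDist_eq_dist hA (nmean fun j => x j t)
      refine ⟨g ⟨0, hN⟩ t z, L * Metric.infDist (nmean fun j => x j t) A, ?_, ?_⟩
      · intro i
        rw [hagree ⟨0, hN⟩ i t z hzA, hz, dist_eq_norm]
        exact hlip i t _ _
      · have h1 := htri t
        have h2 := hφA t ht.1
        have h3 : (0:ℝ) ≤ Metric.infDist (nmean fun j => x j t) A := Metric.infDist_nonneg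
        set u := ‖(nmean fun j => x j t) - φ t‖
        have h4 : Metric.infDist (nmean fun j => x j t) A ^ 2 ≤ (c * a0 + u) ^ 2 := by
          gcongr
          linarith
        have h5 : (c * a0 + u) ^ 2 ≤ 2 * c ^ 2 * a0 ^ 2 + 2 * u ^ 2 := by
          nlinarith [sq_nonneg (c * a0 - u)]
        rw [mul_pow]
        nlinarith [sq_nonneg L])
  rw [hφ0, sub_self, norm_zero, ← hC1, ← hV0] at hest
  have hUb : C1 * (0 ^ 2 + (V0 + 2 * L ^ 2 * c ^ 2 * a0 ^ 2) / κ) ≤ C2 * S / κ := by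
    have e : C2 * S / κ = C1 * ((1 + 2 * L ^ 2 * c ^ 2) * S / κ) := by rw [hC2]; ring
    rw [e]
    refine mul_le_mul_of_nonneg_left ?_ hC10
    rw [zero_pow two_ne_zero, zero_add]
    apply div_le_div_of_nonneg_right _ hκ0.le
    rw [hS]
    have : 0 ≤ 2 * L ^ 2 * c ^ 2 * V0 := by positivity
    nlinarith [sq_nonneg a0]
  have hU : ∀ t ∈ Set.Icc a (a + T), ‖(nmean fun j => x j t) - φ t‖ ^ 2 ≤ C2 * S / κ :=
    fun t ht => (hest t ht).1.trans hUb
  have hV : ∀ t ∈ Set.Icc a (a + T), (ndis fun j => x j t) ≤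
      Real.exp (-κ * (t - a)) * V0 + C3 * S / κ := by
    intro t ht
    refine (hest t ht).2.trans ?_
    have h1 : C2 * S / κ ≤ C2 * S := div_le_self (by positivity) hκ1
    have h2 : a0 ^ 2 ≤ S := by linarith
    have h3 : (N : ℝ) / κ * (2 * L ^ 2 * c ^ 2 * a0 ^ 2 + 2 * L ^ 2 *
        (C1 * (0 ^ 2 + (V0 + 2 * L ^ 2 * c ^ 2 * a0 ^ 2) / κ))) ≤
        (N : ℝ) / κ * (2 * L ^ 2 * c ^ 2 * S + 2 * L ^ 2 * (C2 * S)) := by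
      exact mul_le_mul_of_nonneg_left (add_le_add (mul_le_mul_of_nonneg_left h2 (by positivity))
        (mul_le_mul_of_nonneg_left (hUb.trans h1) (by positivity))) (by positivity)
    have h4 : (N : ℝ) / κ * (2 * L ^ 2 * c ^ 2 * S + 2 * L ^ 2 * (C2 * S)) = C3 * S / κ := by
      rw [hC3]; ring
    linarith
  have hdd : ∀ t b, 0 ≤ b → Metric.infDist (φ t) A ≤ b →
      Metric.infDist (nmean fun j => x j t) A ^ 2 ≤
        2 * b ^ 2 + 2 * ‖(nmean fun j => x j t) - φ t‖ ^ 2 := by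
    intro t b hb hb'
    have h1 := htri t
    have h3 : (0:ℝ) ≤ Metric.infDist (nmean fun j => x j t) A := Metric.infDist_nonneg
    set u := ‖(nmean fun j => x j t) - φ t‖
    have h4 : Metric.infDist (nmean fun j => x j t) A ^ 2 ≤ (b + u) ^ 2 := by
      gcongr
      linarith
    nlinarith [sq_nonneg (b - u)]
  constructor
  · have hmem : a + T ∈ Set.Icc a (a + T) := ⟨by linarith, le_rfl⟩
    have h1 := hdd (a + T) (1 / 4 * a0) (by positivity) hφT
    have h2 := hU _ hmem
    have h3 := hV _ hmem
    rw [add_sub_cancel_left] at h3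
    have h4 : Real.exp (-κ * T) * V0 ≤ T⁻¹ / κ * S :=
      mul_le_mul (exp_neg_le_inv hκ0 hT) (by linarith [sq_nonneg a0]) hV00 (by positivity)
    have h5 : (2 * C2 + T⁻¹ + C3) / κ * S ≤ 1 / 4 * S := by
      apply mul_le_mul_of_nonneg_right _ hS0
      rw [div_le_iff₀ hκ0]
      linarith
    have h6 : (2 * C2 + T⁻¹ + C3) / κ * S = 2 * (C2 * S / κ) + T⁻¹ / κ * S + C3 * S / κ := by
      ring
    have h7 : (1 / 4 * a0) ^ 2 = 1 / 16 * a0 ^ 2 := by ring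
    rw [h7] at h1
    linarith
  · intro t ht
    have h2 := hU _ ht
    have h3 := hV _ ht
    have hC2κ : C2 * S / κ ≤ S := by
      rw [div_le_iff₀ hκ0, mul_comm S]
      exact mul_le_mul_of_nonneg_right (by linarith) hS0
    have hC3κ : C3 * S / κ ≤ S := by
      rw [div_le_iff₀ hκ0, mul_comm S]
      exact mul_le_mul_of_nonneg_right (by linarith) hS0
    constructor
    · have h1 := hdd t (c * a0) (by positivity) (hφA t ht.1)
      have : c ^ 2 * a0 ^ 2 ≤ c ^ 2 * S := by gcongr; linarith
      rw [mul_pow] at h1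
      linarith
    · have : Real.exp (-κ * (t - a)) ≤ 1 := by
        apply Real.exp_le_one_iff.2
        have : 0 ≤ κ * (t - a) := mul_nonneg hκ0.le (by linarith [ht.1])
        linarith
      have h5 : Real.exp (-κ * (t - a)) * V0 ≤ 1 * V0 := mul_le_mul_of_nonneg_right this hV00
      linarith [sq_nonneg a0]

theorem phase2_all (hN : 0 < N) {g : Fin N → ℝ → E → E} {L lam : ℝ} (hL : 0 ≤ L)
    (hlip : ∀ i t x y, ‖g i t x - g i t y‖ ≤ L * ‖x - y‖) {α : Fin N → Fin N → ℝ}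
    (hdis : ∀ e : Fin N → E, ∑ i, e i = 0 →
      ∑ i, inner ℝ (e i) (∑ j, α i j • (e j - e i)) ≤ -lam * ∑ i, ‖e i‖ ^ 2)
    (hsym : ∀ i j, α i j = α j i) {A : Set E} (hA : A.Nonempty) (hAc : IsCompact A)
    (hagree : ∀ (i j : Fin N) (t : ℝ), ∀ s ∈ A, g i t s = g j t s)
    {c T lam2 δ : ℝ} (hc : 0 < c) (hT : 0 < T) (hlam2 : 0 < lam2)
    (hcT : c * Real.exp (-lam2 * T) ≤ 1 / 4) (hδ : 0 < δ)
    (hφ : ∀ a z, Metric.infDist z A ≤ δ → ∃ φ : ℝ → E, φ a = z ∧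
      (∀ t ≥ a, HasDerivAt φ (nmean fun i => g i t (φ t)) t) ∧
      ∀ t ≥ a, Metric.infDist (φ t) A ≤ c * Real.exp (-lam2 * (t - a)) * Metric.infDist z A) :
    ∃ Kc ≥ (1 : ℝ), ∀ (k κ : ℝ), Kc ≤ κ → 0 ≤ k → κ + L ≤ k * lam →
      ∀ (x : Fin N → ℝ → E) (a : ℝ),
      (∀ i, ∀ t ≥ a, HasDerivAt (x i) (g i t (x i t) + k • ∑ j, α i j • (x j t - x i t)) t) →
      Metric.infDist (nmean fun j => x j a) A ^ 2 + (ndis fun j => x j a) ≤ δ ^ 2 →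
      ∀ t ≥ a,
        Metric.infDist (nmean fun j => x j t) A ^ 2 ≤
          (2 * c ^ 2 + 2) * ((1 / 2) ^ ⌊(t - a) / T⌋₊ * δ ^ 2) ∧
        (ndis fun j => x j t) ≤ 2 * ((1 / 2) ^ ⌊(t - a) / T⌋₊ * δ ^ 2) := by
  obtain ⟨Kc, hKc, H⟩ := phase2_step hN hL hlip hdis hsym hA hAc hagree hc hT
  refine ⟨Kc, hKc, ?_⟩
  intro k κ hκ hk hkκ x a hx h0
  have hstep : ∀ b ≥ a,
      Metric.infDist (nmean fun j => x j b) A ^ 2 + (ndis fun j => x j b) ≤ δ ^ 2 →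
      (Metric.infDist (nmean fun j => x j (b + T)) A ^ 2 + (ndis fun j => x j (b + T)) ≤
        1 / 2 * (Metric.infDist (nmean fun j => x j b) A ^ 2 + (ndis fun j => x j b))) ∧
      ∀ t ∈ Set.Icc b (b + T),
        Metric.infDist (nmean fun j => x j t) A ^ 2 ≤
          (2 * c ^ 2 + 2) * (Metric.infDist (nmean fun j => x j b) A ^ 2 + (ndis fun j => x j b)) ∧
        (ndis fun j => x j t) ≤
          2 * (Metric.infDist (nmean fun j => x j b) A ^ 2 + (ndis fun j => x j b)) := by
    intro b hb hSb
    have hbd : Metric.infDist (nmean fun j => x j b) A ≤ δ := by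
      have := ndis_nonneg fun j => x j b
      exact abs_le_of_sq_le_sq' (by linarith) hδ.le |>.2
    obtain ⟨φ, hφ0, hφ1, hφ2⟩ := hφ b _ hbd
    have hnn : 0 ≤ Metric.infDist (nmean fun j => x j b) A := Metric.infDist_nonneg
    refine H k κ hκ hk hkκ x b (fun i t ht => hx i t (ge_trans ht hb)) φ hφ0 hφ1 ?_ ?_
    · intro t ht
      refine (hφ2 t ht).trans ?_
      have : Real.exp (-lam2 * (t - b)) ≤ 1 := by
        apply Real.exp_le_one_iff.2
        have : 0 ≤ lam2 * (t - b) := mul_nonneg hlam2.le (by linarith)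
        linarith
      have h2 : c * Real.exp (-lam2 * (t - b)) ≤ c * 1 := by gcongr
      nlinarith
    · refine (hφ2 (b + T) (by linarith)).trans ?_
      rw [add_sub_cancel_left]
      gcongr
  have hind : ∀ m : ℕ, Metric.infDist (nmean fun j => x j (a + m * T)) A ^ 2 +
      (ndis fun j => x j (a + m * T)) ≤ (1 / 2) ^ m * δ ^ 2 := by
    intro m
    induction m with
    | zero => simpa using h0
    | succ m ih =>
      have hle : ((1 : ℝ) / 2) ^ m ≤ 1 := pow_le_one₀ (by norm_num) (by norm_num)
      have h1 := (hstep (a + m * T) (by have : 0 ≤ (m : ℝ) * T := by positivity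
                                        linarith) (by nlinarith [sq_nonneg δ])).1
      have h2 : a + ((m + 1 : ℕ) : ℝ) * T = a + m * T + T := by push_cast; ring
      rw [h2, pow_succ (1 / 2 : ℝ) m]
      linarith
  intro t ht
  set m := ⌊(t - a) / T⌋₊ with hm
  have hq : 0 ≤ (t - a) / T := div_nonneg (by linarith) hT.le
  have h1 : (m : ℝ) * T ≤ t - a := (le_div_iff₀ hT).1 (Nat.floor_le hq)
  have h2 : t - a ≤ (m + 1) * T := ((div_lt_iff₀ hT).1 (Nat.lt_floor_add_one _)).le
  have hle : ((1 : ℝ) / 2) ^ m ≤ 1 := pow_le_one₀ (by norm_num) (by norm_num)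
  have hmT : 0 ≤ (m : ℝ) * T := by positivity
  have h3 := (hstep (a + m * T) (by linarith)
    ((hind m).trans (by nlinarith [sq_nonneg δ]))).2 t ⟨by linarith, by linarith⟩
  refine ⟨h3.1.trans ?_, h3.2.trans ?_⟩
  · exact mul_le_mul_of_nonneg_left (hind m) (by positivity)
  · exact mul_le_mul_of_nonneg_left (hind m) (by positivity)

end Phases


section Core
variable {E : Type*} [NormedAddCommGroup E] [InnerProductSpace ℝ E] {N : ℕ}

theorem continuous_nmean : Continuous (nmean : (Fin N → E) → E) := by
  unfold nmean; fun_prop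

theorem continuous_ndis : Continuous (ndis : (Fin N → E) → ℝ) := by
  unfold ndis
  have := continuous_nmean (E := E) (N := N)
  fun_prop

theorem dev_sq_le (X : Fin N → E) (i : Fin N) : ‖X i - nmean X‖ ^ 2 ≤ ndis X :=
  Finset.single_le_sum (f := fun i => ‖X i - nmean X‖ ^ 2) (fun _ _ => by positivity)
    (Finset.mem_univ i)

theorem le_add_one_of_sq_le {a b : ℝ} (h : a ^ 2 ≤ b) : a ≤ b + 1 := by
  nlinarith [sq_nonneg (a - 1)]

theorem tendsto_zero_of_sq {u : ℝ → ℝ} (hu : ∀ t, 0 ≤ u t)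
    (h : Tendsto (fun t => u t ^ 2) atTop (nhds 0)) : Tendsto u atTop (nhds 0) := by
  have := (Real.continuous_sqrt.tendsto 0).comp h
  rw [Real.sqrt_zero] at this
  refine this.congr fun t => ?_
  simp [Real.sqrt_sq (hu t)]

theorem tendsto_half_pow (a T : ℝ) (hT : 0 < T) :
    Tendsto (fun t : ℝ => ((1:ℝ) / 2) ^ ⌊(t - a) / T⌋₊) atTop (nhds 0) := by
  refine (tendsto_pow_atTop_nhds_zero_of_lt_one (by norm_num) (by norm_num)).comp ?_
  refine tendsto_nat_floor_atTop.comp ?_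
  exact (tendsto_atTop_add_const_right _ (-a) tendsto_id).atTop_div_const hT

theorem norm_le_infDist {A : Set E} (hA : A.Nonempty) (hAc : IsCompact A) :
    ∃ B ≥ (0:ℝ), ∀ z, ‖z‖ ≤ B + Metric.infDist z A := by
  obtain ⟨B, hB⟩ := hAc.isBounded.exists_norm_le
  refine ⟨|B|, abs_nonneg _, fun z => ?_⟩
  obtain ⟨p, hp, h⟩ := hAc.exists_infDist_eq_dist hA z
  rw [h, dist_eq_norm]
  have h1 := (hB p hp).trans (le_abs_self B)
  have h2 : ‖z‖ ≤ ‖p‖ + ‖z - p‖ := by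
    have := norm_add_le p (z - p)
    simpa using this
  linarith

theorem exists_net_sol [CompleteSpace E] {g : Fin N → ℝ → E → E} {L M : ℝ} (hL : 0 ≤ L)
    (hM : 0 ≤ M) (hlip : ∀ i t x y, ‖g i t x - g i t y‖ ≤ L * ‖x - y‖)
    (hb : ∀ i t x, ‖g i t x‖ ≤ M) (hc : ∀ i x, Continuous fun t => g i t x)
    (α : Fin N → Fin N → ℝ) (k t₀ : ℝ) (X : Fin N → E) :
    ∃ x : Fin N → ℝ → E, (∀ i, x i t₀ = X i) ∧ ∀ i, ∀ t ≥ t₀,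
      HasDerivAt (x i) (g i t (x i t) + k • ∑ j, α i j • (x j t - x i t)) t := by
  have hS0 : 0 ≤ ∑ i, ∑ j, |α i j| :=
    Finset.sum_nonneg fun i _ => Finset.sum_nonneg fun j _ => abs_nonneg _
  obtain ⟨y, hy0, hy⟩ := exists_sol_global
    (fun t (X : Fin N → E) i => g i t (X i) + k • ∑ j, α i j • (X j - X i))
    (L + |k| * ((∑ i, ∑ j, |α i j|) * 2)) M (by positivity) hM (by
      intro t x y
      refine (pi_norm_le_iff_of_nonneg (by positivity)).2 fun i => ?_
      have e : (g i t (x i) + k • ∑ j, α i j • (x j - x i)) -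
          (g i t (y i) + k • ∑ j, α i j • (y j - y i)) =
          (g i t (x i) - g i t (y i)) + k • ∑ j, α i j • ((x - y) j - (x - y) i) := by
        have : ∑ j, α i j • ((x - y) j - (x - y) i) =
            ∑ j, α i j • (x j - x i) - ∑ j, α i j • (y j - y i) := by
          rw [← Finset.sum_sub_distrib]
          refine Finset.sum_congr rfl fun j _ => ?_
          rw [← smul_sub, Pi.sub_apply, Pi.sub_apply]
          congr 1
          abel
        rw [this, smul_sub]
        abel
      simp only [Pi.sub_apply] at e ⊢
      rw [e]
      have h1 : ‖g i t (x i) - g i t (y i)‖ ≤ L * ‖x - y‖ :=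
        (hlip i t _ _).trans (mul_le_mul_of_nonneg_left (norm_le_pi_norm (x - y) i) hL)
      have h2 : ‖∑ j, α i j • ((x j - y j) - (x i - y i))‖ ≤
          (∑ j, |α i j|) * (2 * ‖x - y‖) := by
        rw [Finset.sum_mul]
        refine norm_sum_le_of_le _ fun j _ => ?_
        rw [norm_smul, Real.norm_eq_abs]
        refine mul_le_mul_of_nonneg_left ?_ (abs_nonneg _)
        have h3 := norm_le_pi_norm (x - y) i
        have h4 := norm_le_pi_norm (x - y) j
        have h5 := norm_sub_le (x j - y j) (x i - y i)
        simp only [Pi.sub_apply] at h3 h4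
        linarith
      have h6 : ∑ j, |α i j| ≤ ∑ i, ∑ j, |α i j| :=
        Finset.single_le_sum (f := fun i => ∑ j, |α i j|)
          (fun i _ => Finset.sum_nonneg fun j _ => abs_nonneg _) (Finset.mem_univ i)
      have h7 : ‖k • ∑ j, α i j • ((x j - y j) - (x i - y i))‖ ≤
          |k| * ((∑ i, ∑ j, |α i j|) * (2 * ‖x - y‖)) := by
        rw [norm_smul, Real.norm_eq_abs]
        refine mul_le_mul_of_nonneg_left (h2.trans ?_) (abs_nonneg _)
        exact mul_le_mul_of_nonneg_right h6 (by positivity)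
      refine (norm_add_le _ _).trans ((add_le_add h1 h7).trans (le_of_eq (by ring))))
    (by
      intro t
      refine (pi_norm_le_iff_of_nonneg hM).2 fun i => ?_
      simpa using hb i t 0)
    (by
      intro x
      refine continuous_pi fun i => ?_
      exact (hc i _).add continuous_const) t₀ X
  refine ⟨fun i t => y t i, fun i => congrFun hy0 i, fun i t ht => ?_⟩
  exact (hasDerivAt_pi.1 (hy t ht)) i

theorem phase1 (hN : 0 < N) {g : Fin N → ℝ → E → E} {L lam M : ℝ} (hL : 0 ≤ L)
    (hlip : ∀ i t x y, ‖g i t x - g i t y‖ ≤ L * ‖x - y‖) (hb : ∀ i t x, ‖g i t x‖ ≤ M)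
    {α : Fin N → Fin N → ℝ}
    (hdis : ∀ e : Fin N → E, ∑ i, e i = 0 →
      ∑ i, inner ℝ (e i) (∑ j, α i j • (e j - e i)) ≤ -lam * ∑ i, ‖e i‖ ^ 2)
    (hsym : ∀ i j, α i j = α j i) {t₀ T η : ℝ} (hT : 0 < T) (hη : 0 < η)
    {X₀ : Fin N → E} {φ : ℝ → E} (hφ0 : φ t₀ = nmean X₀)
    (hφ : ∀ t ≥ t₀, HasDerivAt φ (nmean fun i => g i t (φ t)) t) :
    ∃ K1 ≥ (1:ℝ), ∀ᶠ X in nhds X₀, ∀ k κ, K1 ≤ κ → 0 ≤ k → κ + L ≤ k * lam →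
      ∀ x : Fin N → ℝ → E, (∀ i, x i t₀ = X i) →
      (∀ i, ∀ t ≥ t₀, HasDerivAt (x i) (g i t (x i t) + k • ∑ j, α i j • (x j t - x i t)) t) →
      (∀ t ∈ Set.Icc t₀ (t₀ + T), ‖(nmean fun j => x j t) - φ t‖ ^ 2 ≤ η ∧
        (ndis fun j => x j t) ≤ ndis X₀ + 2) ∧
      (ndis fun j => x j (t₀ + T)) ≤ η := by
  set C1 := Real.exp ((3 * L + L * N * 0) * T) * (1 + L + T * L * N) with hC1
  have hC10 : 0 ≤ C1 := by positivity
  clear_value C1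
  have hX0 := ndis_nonneg X₀
  set W := ndis X₀ + 1 with hW
  have hW0 : 0 < W := by linarith
  refine ⟨1 + 2 * C1 * (W + M ^ 2) / η + N * M ^ 2 + (T⁻¹ * W + N * M ^ 2) / η, ?_, ?_⟩
  · have h1 : 0 ≤ 2 * C1 * (W + M ^ 2) / η := by positivity
    have h2 : 0 ≤ N * M ^ 2 := by positivity
    have h3 : 0 ≤ (T⁻¹ * W + N * M ^ 2) / η := by positivity
    linarith
  have c1 : Continuous fun X : Fin N → E => C1 * ‖nmean X - nmean X₀‖ ^ 2 := by
    have := continuous_nmean (E := E) (N := N)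
    fun_prop
  have e1 : ∀ᶠ X in nhds X₀, C1 * ‖nmean X - nmean X₀‖ ^ 2 < η / 2 := by
    refine (c1.tendsto X₀).eventually (gt_mem_nhds ?_)
    simpa using hη
  have e2 : ∀ᶠ X in nhds X₀, ndis X < W :=
    (continuous_ndis.tendsto X₀).eventually (gt_mem_nhds (by linarith))
  filter_upwards [e1, e2] with X h1 h2 k κ hκ hk hkκ x hx0 hx
  have a1 : 0 ≤ 2 * C1 * (W + M ^ 2) / η := by positivity
  have a2 : 0 ≤ N * M ^ 2 := by positivity
  have a3 : 0 ≤ (T⁻¹ * W + N * M ^ 2) / η := by positivity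
  have hκ1 : 1 ≤ κ := by linarith
  have hκ0 : 0 < κ := by linarith
  have hest := interval_est hN hL hlip hdis hsym hκ1 hk hkκ hT.le hx hφ
    (P := M ^ 2) (Q := 0) (by positivity) le_rfl (by
      intro t ht
      exact ⟨0, M, fun i => by simpa using hb i t _, by simp⟩)
  have hxX : (fun j => x j t₀) = X := funext hx0
  rw [hxX, hφ0, ← hC1] at hest
  have hVX := ndis_nonneg X
  have hV : ∀ t ∈ Set.Icc t₀ (t₀ + T), (ndis fun j => x j t) ≤
      Real.exp (-κ * (t - t₀)) * ndis X + N * M ^ 2 / κ := by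
    intro t ht
    refine (hest t ht).2.trans (le_of_eq ?_)
    ring
  refine ⟨fun t ht => ⟨?_, ?_⟩, ?_⟩
  · refine (hest t ht).1.trans ?_
    have h3 : C1 * ((ndis X + M ^ 2) / κ) ≤ η / 2 := by
      rw [← mul_div_assoc, div_le_iff₀ hκ0]
      have : 2 * C1 * (W + M ^ 2) / η ≤ κ := by linarith
      rw [div_le_iff₀ hη] at this
      have h4 : C1 * (ndis X + M ^ 2) ≤ C1 * (W + M ^ 2) :=
        mul_le_mul_of_nonneg_left (by linarith) hC10
      linarith
    rw [mul_add]
    linarith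
  · refine (hV t ht).trans ?_
    have h3 : Real.exp (-κ * (t - t₀)) ≤ 1 := by
      apply Real.exp_le_one_iff.2
      have : 0 ≤ κ * (t - t₀) := mul_nonneg hκ0.le (by linarith [ht.1])
      linarith
    have h4 := mul_le_mul_of_nonneg_right h3 hVX
    have h5 : N * M ^ 2 / κ ≤ 1 := (div_le_one hκ0).2 (by linarith)
    linarith
  · refine (hV _ ⟨by linarith, le_rfl⟩).trans ?_
    rw [add_sub_cancel_left]
    have h3 : Real.exp (-κ * T) * ndis X ≤ T⁻¹ / κ * W :=
      mul_le_mul (exp_neg_le_inv hκ0 hT) h2.le hVX (by positivity)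
    have h4 : (T⁻¹ * W + N * M ^ 2) / κ ≤ η := by
      rw [div_le_iff₀ hκ0]
      have : (T⁻¹ * W + N * M ^ 2) / η ≤ κ := by linarith
      rw [div_le_iff₀ hη] at this
      linarith
    have h5 : (T⁻¹ * W + N * M ^ 2) / κ = T⁻¹ / κ * W + N * M ^ 2 / κ := by ring
    linarith

theorem core [CompleteSpace E] (hN : 0 < N) {f : Fin N → ℝ → E → E} {lam : ℝ} (hlam : 0 < lam)
    {α : Fin N → Fin N → ℝ}
    (hdis : ∀ e : Fin N → E, ∑ i, e i = 0 →
      ∑ i, inner ℝ (e i) (∑ j, α i j • (e j - e i)) ≤ -lam * ∑ i, ‖e i‖ ^ 2)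
    (hsym : ∀ i j, α i j = α j i)
    (hfc : ∀ i x, Continuous fun t => f i t x)
    (hloc : ∀ i R, ∃ L : ℝ, 0 ≤ L ∧ ∀ t x y, ‖x‖ ≤ R → ‖y‖ ≤ R → ‖f i t x - f i t y‖ ≤ L * ‖x - y‖)
    (hbd : ∀ i, ∃ C : ℝ, ∀ t, ‖f i t 0‖ ≤ C)
    {A D : Set E} (hA : A.Nonempty) (hAc : IsCompact A) (hD : IsOpen D) (hAD : A ⊆ D)
    (hex : ∀ a, ∀ z ∈ D, ∃ φ : ℝ → E, φ a = z ∧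
      ∀ t ≥ a, HasDerivAt φ (nmean fun i => f i t (φ t)) t)
    (t₀ : ℝ)
    (hatt : ∀ φ : ℝ → E, (∀ t ≥ t₀, HasDerivAt φ (nmean fun i => f i t (φ t)) t) → φ t₀ ∈ D →
      ∀ ε > 0, ∃ T > 0, ∀ t ≥ t₀ + T, Metric.infDist (φ t) A < ε)
    {δ c lam2 : ℝ} (hδ : 0 < δ) (hc : 0 < c) (hlam2 : 0 < lam2)
    (hles : ∀ a, ∀ φ : ℝ → E, (∀ t ≥ a, HasDerivAt φ (nmean fun i => f i t (φ t)) t) →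
      Metric.infDist (φ a) A ≤ δ →
      ∀ t ≥ a, Metric.infDist (φ t) A ≤ c * Real.exp (-lam2 * (t - a)) * Metric.infDist (φ a) A)
    (hagree : ∀ (i j : Fin N) (t : ℝ), ∀ s ∈ A, f i t s = f j t s)
    (X₀ : Fin N → E) (hX₀ : nmean X₀ ∈ D) :
    ∃ k0 > (0:ℝ), ∀ᶠ X in nhds X₀, ∀ k > k0, ∃ x : Fin N → ℝ → E,
      (∀ i, x i t₀ = X i) ∧
      (∀ i, ∀ t ≥ t₀, HasDerivAt (x i) (f i t (x i t) + k • ∑ j, α i j • (x j t - x i t)) t) ∧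
      (∀ i j, Tendsto (fun t => ‖x i t - x j t‖) atTop (nhds 0)) ∧
      (∀ i, Tendsto (fun t => Metric.infDist (x i t) A) atTop (nhds 0)) := by
  obtain ⟨δ1, hδ1, hδ1D⟩ := hAc.exists_cthickening_subset_open hD hAD
  set δ2 := min δ1 δ with hδ2
  have hδ20 : 0 < δ2 := lt_min hδ1 hδ
  have hδ2a : δ2 ≤ δ1 := min_le_left _ _
  have hδ2b : δ2 ≤ δ := min_le_right _ _
  clear_value δ2
  have hzD : ∀ z, Metric.infDist z A ≤ δ2 → z ∈ D := by
    intro z hz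
    apply hδ1D
    rw [hAc.cthickening_eq_biUnion_closedBall hδ1.le]
    obtain ⟨p, hp, h⟩ := hAc.exists_infDist_eq_dist hA z
    exact Set.mem_iUnion₂.2 ⟨p, hp, by rw [Metric.mem_closedBall, ← h]; linarith⟩
  obtain ⟨BA, hBA0, hBA⟩ := norm_le_infDist hA hAc
  -- reference solution
  obtain ⟨φ, hφ0, hφ⟩ := hex t₀ _ hX₀
  obtain ⟨T, hT, hφT⟩ := hatt φ hφ (by rw [hφ0]; exact hX₀) (δ2 / 4) (by linarith)
  obtain ⟨B0, hB00, hB0⟩ : ∃ B0 ≥ (0:ℝ), ∀ t ≥ t₀, ‖φ t‖ ≤ B0 := by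
    obtain ⟨B, hB⟩ := (isCompact_Icc (a := t₀) (b := t₀ + T)).exists_bound_of_continuousOn
      (f := φ) (fun t ht => (hφ t ht.1).continuousAt.continuousWithinAt)
    refine ⟨|B| + BA + δ2, by positivity, fun t ht => ?_⟩
    by_cases h : t ≤ t₀ + T
    · have := (hB t ⟨ht, h⟩).trans (le_abs_self B)
      linarith
    · have h1 := hφT t (by linarith)
      have h2 := hBA (φ t)
      have h3 := abs_nonneg B
      linarith
  have hV00 := ndis_nonneg X₀
  obtain ⟨R, hR1, hR2, hR3, hR4, hR0⟩ : ∃ R : ℝ, B0 ≤ R ∧ B0 + (1 + 1) + (ndis X₀ + 2 + 1) ≤ R ∧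
      BA + c * δ2 ≤ R ∧
      BA + ((2 * c ^ 2 + 2) * δ2 ^ 2 + 1) + (2 * δ2 ^ 2 + 1) ≤ R ∧ 0 < R := by
    have h1 : 0 ≤ c * δ2 := by positivity
    have h2 : 0 ≤ (2 * c ^ 2 + 2) * δ2 ^ 2 := by positivity
    have h3 : 0 ≤ 2 * δ2 ^ 2 := by positivity
    refine ⟨B0 + (1 + 1) + (ndis X₀ + 2 + 1) + (BA + c * δ2) +
      ((2 * c ^ 2 + 2) * δ2 ^ 2 + 1) + (2 * δ2 ^ 2 + 1), ?_, ?_, ?_, ?_, ?_⟩ <;> linarith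
  -- truncated vector field
  obtain ⟨L, hL, M, hM, hlip, hb⟩ : ∃ L : ℝ, 0 ≤ L ∧ ∃ M : ℝ, 0 ≤ M ∧
      (∀ i t x y, ‖f i t (rretr R x) - f i t (rretr R y)‖ ≤ L * ‖x - y‖) ∧
      (∀ i t x, ‖f i t (rretr R x)‖ ≤ M) := by
    choose Li hLi0 hLi using fun i => hloc i R
    choose Ci hCi using hbd
    have hS : ∀ i, Li i ≤ ∑ i, Li i := fun i =>
      Finset.single_le_sum (fun i _ => hLi0 i) (Finset.mem_univ i)
    have hS' : ∀ i, Ci i ≤ ∑ i, |Ci i| := fun i => (le_abs_self _).trans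
      (Finset.single_le_sum (f := fun i => |Ci i|) (fun i _ => abs_nonneg _) (Finset.mem_univ i))
    have hS0 : 0 ≤ ∑ i, Li i := Finset.sum_nonneg fun i _ => hLi0 i
    have hS0' : 0 ≤ ∑ i, |Ci i| := Finset.sum_nonneg fun i _ => abs_nonneg _
    refine ⟨(∑ i, Li i) * 2, by positivity, (∑ i, Li i) * R + ∑ i, |Ci i|, by positivity, ?_, ?_⟩
    · intro i t x y
      have h1 := hLi i t _ _ (rretr_norm_le hR0 x) (rretr_norm_le hR0 y)
      refine h1.trans ?_
      rw [mul_assoc]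
      exact mul_le_mul (hS i) (rretr_lip hR0 x y) (norm_nonneg _) hS0
    · intro i t x
      have h1 := hLi i t _ 0 (rretr_norm_le hR0 x) (by simpa using hR0.le)
      rw [sub_zero] at h1
      have h2 : Li i * ‖rretr R x‖ ≤ (∑ i, Li i) * R :=
        mul_le_mul (hS i) (rretr_norm_le hR0 x) (norm_nonneg _) hS0
      have h3 := (hCi i t).trans (hS' i)
      have h4 : ‖f i t (rretr R x)‖ ≤ ‖f i t (rretr R x) - f i t 0‖ + ‖f i t 0‖ := by
        have := norm_add_le (f i t (rretr R x) - f i t 0) (f i t 0)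
        simpa using this
      linarith
  have hgeq : ∀ i t x, ‖x‖ ≤ R → f i t (rretr R x) = f i t x := by
    intro i t x hx
    rw [rretr_eq hR0 hx]
  -- phase 1
  obtain ⟨η, hη0, hη1, hη2⟩ : ∃ η : ℝ, 0 < η ∧ η ≤ 1 ∧ η ≤ δ2 ^ 2 / 16 :=
    ⟨min 1 (δ2 ^ 2 / 16), lt_min one_pos (by positivity), min_le_left _ _, min_le_right _ _⟩
  obtain ⟨K1, hK1, hph1⟩ := phase1 (g := fun i t x => f i t (rretr R x)) hN hL hlip hb hdis hsym
    hT hη0 hφ0 (fun t ht => by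
      have h := hφ t ht
      simp only [hgeq _ t (φ t) ((hB0 t ht).trans hR1)]
      exact h)
  -- phase 2
  have hT2 : 0 < 4 * c / lam2 := by positivity
  have hcT2 : c * Real.exp (-lam2 * (4 * c / lam2)) ≤ 1 / 4 := by
    have h1 := mul_le_mul_of_nonneg_left (exp_neg_le_inv hlam2 hT2) hc.le
    have h2 : c * ((4 * c / lam2)⁻¹ / lam2) = 1 / 4 := by field_simp
    linarith
  set T2 := 4 * c / lam2 with hT2def
  clear_value T2
  have hnormA : ∀ z ∈ A, ‖z‖ ≤ R := by
    intro z hz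
    have h1 := hBA z
    rw [Metric.infDist_zero_of_mem hz] at h1
    have h2 : 0 ≤ c * δ2 := by positivity
    linarith
  obtain ⟨Kc, hKc, hph2⟩ := phase2_all (g := fun i t x => f i t (rretr R x)) hN hL hlip hdis hsym
    hA hAc (fun i j t s hs => by
      simp only [hgeq _ t s (hnormA s hs)]
      exact hagree i j t s hs) hc hT2 hlam2 hcT2 hδ20 (by
      intro a z hz
      obtain ⟨ψ, hψ0, hψ⟩ := hex a z (hzD z hz)
      have h1 := hles a ψ hψ (by rw [hψ0]; linarith)
      rw [hψ0] at h1
      refine ⟨ψ, hψ0, fun t ht => ?_, h1⟩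
      have h2 : ‖ψ t‖ ≤ R := by
        have h3 := hBA (ψ t)
        have h4 := h1 t ht
        have h5 : Real.exp (-lam2 * (t - a)) ≤ 1 := by
          apply Real.exp_le_one_iff.2
          have : 0 ≤ lam2 * (t - a) := mul_nonneg hlam2.le (by linarith)
          linarith
        have h6 : c * Real.exp (-lam2 * (t - a)) * Metric.infDist z A ≤ c * 1 * δ2 := by
          gcongr
          exact Metric.infDist_nonneg
        linarith
      have h := hψ t ht
      simp only [hgeq _ t (ψ t) h2]
      exact h)
  refine ⟨(K1 + Kc + L) / lam, by positivity, ?_⟩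
  filter_upwards [hph1] with X hX k hk
  have hk' : K1 + Kc + L < k * lam := (div_lt_iff₀ hlam).1 hk
  have hk0 : 0 ≤ k := by
    have : 0 < (K1 + Kc + L) / lam := by positivity
    linarith
  obtain ⟨x, hx0, hx⟩ := exists_net_sol (g := fun i t x => f i t (rretr R x)) hL hM hlip hb
    (fun i x => hfc i _) α k t₀ X
  obtain ⟨hA1, hA2⟩ := hX k (k * lam - L) (by linarith) hk0 (by linarith) x hx0 hx
  have hS1 : Metric.infDist (nmean fun j => x j (t₀ + T)) A ^ 2 +
      (ndis fun j => x j (t₀ + T)) ≤ δ2 ^ 2 := by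
    have h1 := (hA1 (t₀ + T) ⟨by linarith, le_rfl⟩).1
    have h2 := hφT (t₀ + T) le_rfl
    have h3 : Metric.infDist (nmean fun j => x j (t₀ + T)) A ≤
      Metric.infDist (φ (t₀ + T)) A + ‖(nmean fun j => x j (t₀ + T)) - φ (t₀ + T)‖ := by
      rw [← dist_eq_norm]
      exact Metric.infDist_le_infDist_add_dist
    have h4 : 0 ≤ Metric.infDist (nmean fun j => x j (t₀ + T)) A := Metric.infDist_nonneg
    set u := ‖(nmean fun j => x j (t₀ + T)) - φ (t₀ + T)‖
    have h5 : Metric.infDist (nmean fun j => x j (t₀ + T)) A ^ 2 ≤ (δ2 / 4 + u) ^ 2 := by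
      gcongr
      linarith
    nlinarith [sq_nonneg (δ2 / 4 - u)]
  have hB := hph2 k (k * lam - L) (by linarith) hk0 (by linarith) x (t₀ + T)
    (fun i t ht => hx i t (by linarith)) hS1
  have hbox : ∀ i, ∀ t ≥ t₀, ‖x i t‖ ≤ R := by
    intro i t ht
    have hd := dev_sq_le (fun j => x j t) i
    have htri : ‖x i t‖ ≤ ‖nmean fun j => x j t‖ + ‖x i t - nmean fun j => x j t‖ := by
      have := norm_add_le (nmean fun j => x j t) (x i t - nmean fun j => x j t)
      simpa using this
    by_cases h : t ≤ t₀ + T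
    · obtain ⟨h1, h2⟩ := hA1 t ⟨ht, h⟩
      have h3 := le_add_one_of_sq_le (h1.trans hη1)
      have h4 := le_add_one_of_sq_le (hd.trans h2)
      have h5 : ‖nmean fun j => x j t‖ ≤ ‖φ t‖ + ‖(nmean fun j => x j t) - φ t‖ := by
        have := norm_add_le (φ t) ((nmean fun j => x j t) - φ t)
        simpa using this
      have h6 := hB0 t ht
      linarith
    · obtain ⟨h1, h2⟩ := hB t (by linarith)
      have hle : ((1 : ℝ) / 2) ^ ⌊(t - (t₀ + T)) / T2⌋₊ ≤ 1 :=
        pow_le_one₀ (by norm_num) (by norm_num)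
      have hle2 := mul_le_mul_of_nonneg_right hle (sq_nonneg δ2)
      rw [one_mul] at hle2
      have h3 := le_add_one_of_sq_le (h1.trans (mul_le_mul_of_nonneg_left hle2 (by positivity)))
      have h4 := le_add_one_of_sq_le (hd.trans (h2.trans
        (mul_le_mul_of_nonneg_left hle2 (by norm_num))))
      have h5 := hBA (nmean fun j => x j t)
      linarith
  have hr := tendsto_half_pow (t₀ + T) T2 hT2
  have hr2 := hr.mul_const (δ2 ^ 2)
  rw [zero_mul] at hr2
  have hl1 : Tendsto (fun t => Metric.infDist (nmean fun j => x j t) A) atTop (nhds 0) := by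
    refine tendsto_zero_of_sq (fun t => Metric.infDist_nonneg) ?_
    have h3 := hr2.const_mul (2 * c ^ 2 + 2)
    rw [mul_zero] at h3
    refine tendsto_of_tendsto_of_tendsto_of_le_of_le' tendsto_const_nhds h3
      (Eventually.of_forall fun t => by positivity) ?_
    filter_upwards [eventually_ge_atTop (t₀ + T)] with t ht using (hB t ht).1
  have hl2 : ∀ i, Tendsto (fun t => ‖x i t - nmean fun j => x j t‖) atTop (nhds 0) := by
    intro i
    refine tendsto_zero_of_sq (fun t => norm_nonneg _) ?_
    have h3 := hr2.const_mul 2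
    rw [mul_zero] at h3
    refine tendsto_of_tendsto_of_tendsto_of_le_of_le' tendsto_const_nhds h3
      (Eventually.of_forall fun t => by positivity) ?_
    filter_upwards [eventually_ge_atTop (t₀ + T)] with t ht using
      (dev_sq_le (fun j => x j t) i).trans (hB t ht).2
  refine ⟨x, hx0, ?_, ?_, ?_⟩
  · intro i t ht
    have h := hx i t ht
    simp only [hgeq i t (x i t) (hbox i t ht)] at h
    exact h
  · intro i j
    have h3 := (hl2 i).add (hl2 j)
    rw [add_zero] at h3
    refine squeeze_zero (fun t => norm_nonneg _) (fun t => ?_) h3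
    have := norm_sub_le (x i t - nmean fun j => x j t) (x j t - nmean fun j => x j t)
    simpa using this
  · intro i
    have h3 := hl1.add (hl2 i)
    rw [add_zero] at h3
    refine squeeze_zero (fun t => Metric.infDist_nonneg) (fun t => ?_) h3
    rw [← dist_eq_norm]
    exact Metric.infDist_le_infDist_add_dist

end Core

theorem lap_mulVec {N : ℕ} (α : Fin N → Fin N → ℝ) (v : Fin N → ℝ) (i : Fin N) :
    (lapMat α *ᵥ v) i = -∑ j, α i j * (v j - v i) := by
  simp only [Matrix.mulVec, dotProduct, lapMat, Matrix.of_apply, sub_mul, ite_mul, zero_mul,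
    mul_sub, Finset.sum_sub_distrib, Finset.sum_ite_eq, Finset.mem_univ, if_true, Finset.sum_mul]
  ring

theorem lap_gap {N : ℕ} (α : Fin N → Fin N → ℝ)
    (hpsd : (lapMat α).PosSemidef)
    (hconn : LinearMap.ker (lapMat α).mulVecLin
      = Submodule.span ℝ {(fun _ => 1 : Fin N → ℝ)}) :
    ∃ lam > (0:ℝ), ∀ v : Fin N → ℝ, ∑ i, v i = 0 →
      lam * ∑ i, v i ^ 2 ≤ v ⬝ᵥ (lapMat α *ᵥ v) := by
  set S : Set (Fin N → ℝ) := {v | ∑ i, v i = 0 ∧ ∑ i, v i ^ 2 = 1} with hS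
  have hSc : IsCompact S := by
    apply Metric.isCompact_of_isClosed_isBounded
    · exact (isClosed_eq (by fun_prop) continuous_const).inter
        (isClosed_eq (by fun_prop) continuous_const)
    · refine (Metric.isBounded_closedBall (x := (0 : Fin N → ℝ)) (r := 1)).subset ?_
      intro v hv
      rw [mem_closedBall_zero_iff]
      refine (pi_norm_le_iff_of_nonneg zero_le_one).2 fun i => ?_
      have h1 : v i ^ 2 ≤ ∑ i, v i ^ 2 := Finset.single_le_sum (f := fun i => v i ^ 2)
        (fun i _ => sq_nonneg _) (Finset.mem_univ i)
      rw [hv.2] at h1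
      rw [Real.norm_eq_abs]
      exact abs_le_one_iff_mul_self_le_one.2 (by nlinarith)
  have key : ∃ lam > (0:ℝ), ∀ v ∈ S, lam ≤ v ⬝ᵥ (lapMat α *ᵥ v) := by
    rcases S.eq_empty_or_nonempty with h | h
    · exact ⟨1, one_pos, by simp [h]⟩
    · obtain ⟨v, hv, hmin⟩ := hSc.exists_isMinOn h
        (f := fun v => v ⬝ᵥ (lapMat α *ᵥ v)) (by
          apply Continuous.continuousOn
          fun_prop)
      have h0 : 0 ≤ v ⬝ᵥ (lapMat α *ᵥ v) := by
        have := hpsd.dotProduct_mulVec_nonneg v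
        simpa using this
      refine ⟨v ⬝ᵥ (lapMat α *ᵥ v), lt_of_le_of_ne h0 fun h1 => ?_, fun w hw => hmin hw⟩
      have h2 : lapMat α *ᵥ v = 0 := by
        apply (hpsd.dotProduct_mulVec_zero_iff v).1
        simpa using h1.symm
      have h3 : v ∈ LinearMap.ker (lapMat α).mulVecLin := by
        rw [LinearMap.mem_ker, Matrix.mulVecLin_apply, h2]
      rw [hconn, Submodule.mem_span_singleton] at h3
      obtain ⟨a, rfl⟩ := h3
      obtain ⟨h4, h5⟩ := hv
      simp at h4 h5
      rcases h4 with h4 | h4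
      · simp [h4] at h5
      · simp [h4] at h5
  obtain ⟨lam, hlam, hq⟩ := key
  refine ⟨lam, hlam, fun v hv => ?_⟩
  have hnn : 0 ≤ ∑ i, v i ^ 2 := Finset.sum_nonneg fun i _ => sq_nonneg _
  rcases eq_or_lt_of_le hnn with h | h
  · rw [← h, mul_zero]
    have := hpsd.dotProduct_mulVec_nonneg v
    simpa using this
  · set r := Real.sqrt (∑ i, v i ^ 2) with hr
    have hr0 : 0 < r := Real.sqrt_pos.2 h
    have hr2 : r ^ 2 = ∑ i, v i ^ 2 := Real.sq_sqrt hnn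
    have h1 := hq (r⁻¹ • v) (by
      refine ⟨?_, ?_⟩
      · simp [← Finset.mul_sum, hv]
      · simp only [Pi.smul_apply, smul_eq_mul, mul_pow, ← Finset.mul_sum]
        rw [← hr2]
        field_simp)
    rw [Matrix.mulVec_smul, dotProduct_smul, smul_dotProduct, smul_eq_mul, smul_eq_mul] at h1
    rw [← hr2]
    have h2 := mul_le_mul_of_nonneg_right h1 (sq_nonneg r)
    refine h2.trans (le_of_eq ?_)
    field_simp

theorem lap_dis {N n : ℕ} (α : Fin N → Fin N → ℝ) {lam : ℝ}
    (h : ∀ v : Fin N → ℝ, ∑ i, v i = 0 → lam * ∑ i, v i ^ 2 ≤ v ⬝ᵥ (lapMat α *ᵥ v))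
    (e : Fin N → EuclideanSpace ℝ (Fin n)) (he : ∑ i, e i = 0) :
    ∑ i, inner ℝ (e i) (∑ j, α i j • (e j - e i)) ≤ -lam * ∑ i, ‖e i‖ ^ 2 := by
  have h1 : ∑ i, inner ℝ (e i) (∑ j, α i j • (e j - e i)) =
      -∑ a, (fun i => e i a) ⬝ᵥ (lapMat α *ᵥ fun i => e i a) := by
    simp only [dotProduct, lap_mulVec, PiLp.inner_apply, RCLike.inner_apply, conj_trivial]
    rw [Finset.sum_comm, ← Finset.sum_neg_distrib]
    refine Finset.sum_congr rfl fun a _ => ?_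
    rw [← Finset.sum_neg_distrib]
    refine Finset.sum_congr rfl fun i _ => ?_
    simp
    ring
  have h2 : ∑ i, ‖e i‖ ^ 2 = ∑ a, ∑ i, e i a ^ 2 := by
    rw [Finset.sum_comm]
    refine Finset.sum_congr rfl fun i _ => ?_
    rw [EuclideanSpace.norm_sq_eq]
    simp
  rw [h1, h2, neg_mul, Finset.mul_sum]
  refine neg_le_neg (Finset.sum_le_sum fun a _ => h _ ?_)
  have := congrArg (fun z : EuclideanSpace ℝ (Fin n) => z a) he
  simpa using this

theorem unif_lip {V : Type*} [NormedAddCommGroup V] [NormedSpace ℝ V] [ProperSpace V]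
    {F : ℝ → V → V} (hF : ∀ t, Differentiable ℝ (F t))
    (hl : ∀ x₀, ∃ L : NNReal, ∃ ε > 0, ∀ t, LipschitzOnWith L (F t) (Metric.ball x₀ ε)) (R : ℝ) :
    ∃ L : ℝ, 0 ≤ L ∧ ∀ t x y, ‖x‖ ≤ R → ‖y‖ ≤ R → ‖F t x - F t y‖ ≤ L * ‖x - y‖ := by
  have key : ∃ L : ℝ, 0 ≤ L ∧ ∀ t, ∀ x ∈ Metric.closedBall (0:V) R, ‖fderiv ℝ (F t) x‖ ≤ L := by
    refine (isCompact_closedBall (0:V) R).induction_on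
      (p := fun s => ∃ L : ℝ, 0 ≤ L ∧ ∀ t, ∀ x ∈ s, ‖fderiv ℝ (F t) x‖ ≤ L) ?_ ?_ ?_ ?_
    · exact ⟨0, le_rfl, by simp⟩
    · rintro s t hst ⟨L, hL, h⟩
      exact ⟨L, hL, fun τ x hx => h τ x (hst hx)⟩
    · rintro s t ⟨L, hL, h⟩ ⟨L', hL', h'⟩
      refine ⟨L + L', by positivity, fun τ x hx => ?_⟩
      rcases hx with hx | hx
      · linarith [h τ x hx]
      · linarith [h' τ x hx]
    · intro x hx
      obtain ⟨L, ε, hε, h⟩ := hl x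
      refine ⟨Metric.ball x ε, mem_nhdsWithin_of_mem_nhds (Metric.ball_mem_nhds x hε), L, L.2,
        fun t y hy => ?_⟩
      exact norm_fderiv_le_of_lipschitzOn ℝ (Metric.isOpen_ball.mem_nhds hy) (h t)
  obtain ⟨L, hL, h⟩ := key
  refine ⟨L, hL, fun t x y hx hy => ?_⟩
  exact (convex_closedBall (0:V) R).norm_image_sub_le_of_norm_fderiv_le
    (fun z _ => (hF t).differentiableAt) (h t) (by simpa using hy) (by simpa using hx)

theorem eunorm_eq {n : ℕ} (v : Fin n → ℝ) :
    eunorm v = ‖(EuclideanSpace.equiv (Fin n) ℝ).symm v‖ := by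
  rw [EuclideanSpace.norm_eq, eunorm]
  simp

theorem einfDist_eq {n : ℕ} (x : Fin n → ℝ) (A : Set (Fin n → ℝ)) :
    einfDist x A = Metric.infDist ((EuclideanSpace.equiv (Fin n) ℝ).symm x)
      ((EuclideanSpace.equiv (Fin n) ℝ).symm '' A) := by
  rw [Metric.infDist_eq_iInf, einfDist]
  refine Function.Surjective.iInf_congr
    (fun a : A => (⟨(EuclideanSpace.equiv (Fin n) ℝ).symm a, Set.mem_image_of_mem _ a.2⟩ :
      ((EuclideanSpace.equiv (Fin n) ℝ).symm '' A : Set _))) ?_ ?_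
  · rintro ⟨_, a, ha, rfl⟩
    exact ⟨⟨a, ha⟩, rfl⟩
  · intro a
    rw [eunorm_eq, map_sub, dist_eq_norm]

theorem stmt2
    {N n : ℕ} (hN : 2 ≤ N) (t₀ : ℝ)
    (α : Fin N → Fin N → ℝ)
    (hsym : ∀ i j, α i j = α j i) (hnn : ∀ i j, 0 ≤ α i j) (hdiag : ∀ i, α i i = 0)
    (hpsd : (lapMat α).PosSemidef)
    (hconn : LinearMap.ker (lapMat α).mulVecLin
      = Submodule.span ℝ {(fun _ => 1 : Fin N → ℝ)})
    (f : Fin N → ℝ → (Fin n → ℝ) → Fin n → ℝ)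
    (hreg : ∀ i, Reg (f i))
    (Ab Db : Set (Fin n → ℝ))
    (hAb : Ab.Nonempty) (hAbc : IsCompact Ab) (hDb : IsOpen Db) (hAD : Ab ⊆ Db)
    (hUAS : UAS (fun t s => (N : ℝ)⁻¹ • ∑ i, f i t s) Ab Db)
    (hLES : LES (fun t s => (N : ℝ)⁻¹ • ∑ i, f i t s) Ab)
    (hagree : ∀ (i j : Fin N) (t : ℝ), ∀ s ∈ Ab, f i t s = f j t s)
    (K : Set (Fin N → Fin n → ℝ)) (hK : IsCompact K)
    (hKD : K ⊆ {X : Fin N → Fin n → ℝ | ∃ s ∈ Db, ∃ w : Fin N → Fin n → ℝ,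
      (∑ i, w i = 0) ∧ X = fun i => s + w i}) :
    ∃ kstar > (0:ℝ), ∀ k > kstar, ∀ X₀ ∈ K,
      ∃ x : Fin N → ℝ → Fin n → ℝ,
        (∀ i, x i t₀ = X₀ i) ∧
        (∀ i, ∀ t ≥ t₀, HasDerivAt (x i)
          (f i t (x i t) + k • ∑ j, α i j • (x j t - x i t)) t) ∧
        (∀ i j, Tendsto (fun t => eunorm (x i t - x j t)) atTop (nhds 0)) ∧
        (∀ i, Tendsto (fun t => einfDist (x i t) Ab) atTop (nhds 0)) := by
  obtain ⟨lam, hlam, hgap⟩ := lap_gap α hpsd hconn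
  have hN0 : 0 < N := by omega
  have hNR : (N : ℝ) ≠ 0 := by positivity
  set e := EuclideanSpace.equiv (Fin n) ℝ with he
  have hup : ∀ (φ : ℝ → Fin n → ℝ) (v : Fin n → ℝ) (t : ℝ), HasDerivAt φ v t →
      HasDerivAt (fun t => e.symm (φ t)) (e.symm v) t := fun φ v t h =>
    e.symm.toContinuousLinearMap.hasFDerivAt.comp_hasDerivAt t h
  have hdn : ∀ (φ : ℝ → EuclideanSpace ℝ (Fin n)) (v : EuclideanSpace ℝ (Fin n)) (t : ℝ),
      HasDerivAt φ v t → HasDerivAt (fun t => e (φ t)) (e v) t := fun φ v t h =>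
    e.toContinuousLinearMap.hasFDerivAt.comp_hasDerivAt t h
  set F : Fin N → ℝ → EuclideanSpace ℝ (Fin n) → EuclideanSpace ℝ (Fin n) :=
    fun i t x => e.symm (f i t (e x)) with hF
  have hmean : ∀ t z, (nmean fun i => F i t z) = e.symm ((N : ℝ)⁻¹ • ∑ i, f i t (e z)) := by
    intro t z
    rw [nmean, map_smul, map_sum]
  have hsol : ∀ (φ : ℝ → EuclideanSpace ℝ (Fin n)) (a : ℝ),
      (∀ t ≥ a, HasDerivAt φ (nmean fun i => F i t (φ t)) t) →
      IsSolOn (fun t s => (N : ℝ)⁻¹ • ∑ i, f i t s) (fun t => e (φ t)) a := by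
    intro φ a h t ht
    have h1 := hdn φ _ t (h t ht)
    rw [hmean, e.apply_symm_apply] at h1
    exact h1
  have hinf : ∀ z : EuclideanSpace ℝ (Fin n),
      einfDist (e z) Ab = Metric.infDist z (e.symm '' Ab) := by
    intro z
    rw [einfDist_eq, ← he, e.symm_apply_apply]
  obtain ⟨δ, hδ, c, hc, lam2, hlam2, hles⟩ := hLES
  have hloc : ∀ i R, ∃ L : ℝ, 0 ≤ L ∧ ∀ t x y, ‖x‖ ≤ R → ‖y‖ ≤ R →
      ‖F i t x - F i t y‖ ≤ L * ‖x - y‖ := by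
    intro i R
    obtain ⟨hr1, hr2, hr3, hr4⟩ := hreg i
    have en : ∀ z, ‖e z‖ ≤ ‖e.toContinuousLinearMap‖ * ‖z‖ :=
      fun z => e.toContinuousLinearMap.le_opNorm z
    have sn : ∀ z, ‖e.symm z‖ ≤ ‖e.symm.toContinuousLinearMap‖ * ‖z‖ :=
      fun z => e.symm.toContinuousLinearMap.le_opNorm z
    obtain ⟨L, hL, h⟩ := unif_lip (fun t => (hr2 t).differentiable one_ne_zero) hr3
      (‖e.toContinuousLinearMap‖ * R)
    refine ⟨‖e.symm.toContinuousLinearMap‖ * (L * ‖e.toContinuousLinearMap‖), by positivity, ?_⟩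
    intro t x y hx hy
    have h1 := h t (e x) (e y) ((en x).trans (mul_le_mul_of_nonneg_left hx (norm_nonneg _)))
      ((en y).trans (mul_le_mul_of_nonneg_left hy (norm_nonneg _)))
    have h2 := en (x - y)
    rw [map_sub] at h2
    calc ‖F i t x - F i t y‖ = ‖e.symm (f i t (e x) - f i t (e y))‖ := by rw [map_sub]
      _ ≤ ‖e.symm.toContinuousLinearMap‖ * ‖f i t (e x) - f i t (e y)‖ := sn _
      _ ≤ ‖e.symm.toContinuousLinearMap‖ * (L * (‖e.toContinuousLinearMap‖ * ‖x - y‖)) :=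
        mul_le_mul_of_nonneg_left (h1.trans (mul_le_mul_of_nonneg_left h2 hL)) (norm_nonneg _)
      _ = _ := by ring
  have hmain : ∀ X₀ ∈ K, ∃ k0 > (0:ℝ), ∀ᶠ X in nhds (fun i => e.symm (X₀ i)), ∀ k > k0,
      ∃ x : Fin N → ℝ → EuclideanSpace ℝ (Fin n),
      (∀ i, x i t₀ = X i) ∧
      (∀ i, ∀ t ≥ t₀, HasDerivAt (x i) (F i t (x i t) + k • ∑ j, α i j • (x j t - x i t)) t) ∧
      (∀ i j, Tendsto (fun t => ‖x i t - x j t‖) atTop (nhds 0)) ∧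
      (∀ i, Tendsto (fun t => Metric.infDist (x i t) (e.symm '' Ab)) atTop (nhds 0)) := by
    intro X₀ hX₀
    refine core hN0 hlam (lap_dis α hgap) hsym ?_ hloc ?_ (hAb.image _)
      (hAbc.image e.symm.continuous) (D := e ⁻¹' Db) (hDb.preimage e.continuous) ?_ ?_ t₀ ?_
      hδ hc hlam2 ?_ ?_ _ ?_
    · intro i x
      exact e.symm.continuous.comp ((hreg i).1.comp (continuous_id.prodMk continuous_const))
    · intro i
      obtain ⟨C, hC⟩ := (hreg i).2.2.2
      refine ⟨C, fun t => ?_⟩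
      have h1 := hC t
      rw [eunorm_eq, ← he] at h1
      simpa [hF] using h1
    · rintro _ ⟨a, ha, rfl⟩
      rw [Set.mem_preimage, e.apply_symm_apply]
      exact hAD ha
    · intro a z hz
      obtain ⟨φ, hφ0, hφ⟩ := (hUAS.2 {e z} isCompact_singleton (by simpa using hz)).1 a (e z) rfl
      refine ⟨fun t => e.symm (φ t), by simp [hφ0], fun t ht => ?_⟩
      rw [hmean, e.apply_symm_apply]
      exact hup φ _ t (hφ t ht)
    · intro φ hφ h0 ε hε
      obtain ⟨T, hT, h⟩ := (hUAS.2 {e (φ t₀)} isCompact_singleton (by simpa using h0)).2 ε hε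
      refine ⟨T, hT, fun t ht => ?_⟩
      rw [← hinf]
      exact h t₀ (fun t => e (φ t)) (hsol φ t₀ hφ) rfl t ht
    · intro a φ hφ h0 t ht
      have h1 := hles a (fun t => e (φ t)) (hsol φ a hφ) (by rw [hinf]; exact h0) t ht
      rwa [hinf, hinf] at h1
    · rintro i j t _ ⟨s, hs, rfl⟩
      simp only [hF, e.apply_symm_apply]
      rw [hagree i j t s hs]
    · obtain ⟨s, hs, w, hw, rfl⟩ := hKD hX₀
      have : (nmean fun i => e.symm (s + w i)) = e.symm s := by
        rw [nmean, ← map_sum, ← map_smul, Finset.sum_add_distrib, hw, add_zero, Finset.sum_const,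
          Finset.card_univ, Fintype.card_fin, ← Nat.cast_smul_eq_nsmul ℝ, smul_smul,
          inv_mul_cancel₀ hNR, one_smul]
      rw [Set.mem_preimage, this, e.apply_symm_apply]
      exact hs
  refine hK.induction_on (p := fun K : Set (Fin N → Fin n → ℝ) =>
    ∃ kstar > (0:ℝ), ∀ k > kstar, ∀ X₀ ∈ K,
      ∃ x : Fin N → ℝ → Fin n → ℝ,
        (∀ i, x i t₀ = X₀ i) ∧
        (∀ i, ∀ t ≥ t₀, HasDerivAt (x i)
          (f i t (x i t) + k • ∑ j, α i j • (x j t - x i t)) t) ∧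
        (∀ i j, Tendsto (fun t => eunorm (x i t - x j t)) atTop (nhds 0)) ∧
        (∀ i, Tendsto (fun t => einfDist (x i t) Ab) atTop (nhds 0))) ?_ ?_ ?_ ?_
  · exact ⟨1, one_pos, by simp⟩
  · rintro s t hst ⟨k0, hk0, h⟩
    exact ⟨k0, hk0, fun k hk X hX => h k hk X (hst hX)⟩
  · rintro s t ⟨k0, hk0, h⟩ ⟨k1, hk1, h'⟩
    refine ⟨k0 + k1, by positivity, fun k hk X hX => ?_⟩
    rcases hX with hX | hX
    · exact h k (by linarith) X hX
    · exact h' k (by linarith) X hX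
  · intro X₀ hX₀
    obtain ⟨k0, hk0, h⟩ := hmain X₀ hX₀
    have hcont : Continuous fun (X : Fin N → Fin n → ℝ) (i : Fin N) => e.symm (X i) :=
      continuous_pi fun i => e.symm.continuous.comp (continuous_apply i)
    refine ⟨_, mem_nhdsWithin_of_mem_nhds (hcont.continuousAt.eventually h), k0, hk0, ?_⟩
    intro k hk X hX
    obtain ⟨x, hx0, hx, hl1, hl2⟩ := hX k hk
    refine ⟨fun i t => e (x i t), fun i => ?_, fun i t ht => ?_, fun i j => ?_, fun i => ?_⟩
    · simp only [hx0, e.apply_symm_apply]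
    · have h1 := hdn (x i) _ t (hx i t ht)
      simpa only [hF, map_add, map_smul, map_sum, map_sub, e.apply_symm_apply] using h1
    · refine (hl1 i j).congr fun t => ?_
      rw [eunorm_eq, ← he, map_sub, e.symm_apply_apply, e.symm_apply_apply]
    · refine (hl2 i).congr fun t => ?_
      exact (hinf (x i t)).symm
end

section
/- Consider the output-coupled heterogeneous network ż_i = g_i(t, z_i, y_i) ∈ ℝ^{m_i}, ẏ_i = h_i(t, y_i, z_i) + k·Λ·Σ_{j∈N_i} α_{ij}(y_j − y_i) ∈ ℝ^n, i = 1,…,N, over an undirected connected weighted graph with Λ symmetric positive definite, and its blended dynamics ẑ̇_i = g_i(t, ẑ_i, s) (i = 1,…,N), ṡ = (1/N)·Σ_{i=1}^N h_i(t, s, ẑ_i) on ℝ^{m_1+⋯+m_N+n}. Assume the blended dynamics is contractive. Then for every compact set K and every η > 0 there exists k* > 0 such that for every k > k* and every initial condition (z_1(t₀), y_1(t₀), …, z_N(t₀), y_N(t₀)) ∈ K, the solution of the network exists for all t ≥ t₀ and satisfies limsup_{t→∞} ‖z_i(t) − ẑ_i(t)‖ ≤ η and limsup_{t→∞} ‖y_i(t)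 − s(t)‖ ≤ η for every i, where (ẑ_1,…,ẑ_N, s) is the solution of the blended dynamics with ẑ_i(t₀) = z_i(t₀) and s(t₀) = (1/N)·Σ_{i=1}^N y_i(t₀). -/
open Filter Matrix

/-- Regularity of a time-varying vector field with two state arguments. -/
def Reg2 {d₁ d₂ d₃ : ℕ} (g : ℝ → (Fin d₁ → ℝ) → (Fin d₂ → ℝ) → Fin d₃ → ℝ) : Prop :=
  Continuous (fun p : ℝ × (Fin d₁ → ℝ) × (Fin d₂ → ℝ) => g p.1 p.2.1 p.2.2) ∧
  (∀ t, ContDiff ℝ 1 (fun p : (Fin d₁ → ℝ) × (Fin d₂ → ℝ) => g t p.1 p.2)) ∧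
  (∀ p₀ : (Fin d₁ → ℝ) × (Fin d₂ → ℝ), ∃ L : NNReal, ∃ ε > 0, ∀ t,
    LipschitzOnWith L (fun p : (Fin d₁ → ℝ) × (Fin d₂ → ℝ) => g t p.1 p.2) (Metric.ball p₀ ε)) ∧
  (∃ C : ℝ, ∀ t, eunorm (g t 0 0) ≤ C)

/-- Contractivity of `ṡ = F(t,s)`. -/
def Contractive {ι : Type*} [Fintype ι] [DecidableEq ι]
    (F : ℝ → (ι → ℝ) → ι → ℝ) : Prop :=
  ∃ Θ : Matrix ι ι ℝ, Θ.PosDef ∧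
    ∀ (t : ℝ) (s : ι → ℝ), ∃ J : Matrix ι ι ℝ,
      HasFDerivAt (F t) (LinearMap.toContinuousLinearMap J.mulVecLin) s ∧
      (-1 - (Θ * J + Jᵀ * Θ) : Matrix ι ι ℝ).PosSemidef

/-- The combined vector field of the blended dynamics
`ẑ̇ᵢ = gᵢ(t, ẑᵢ, s)`, `ṡ = (1/N) Σᵢ hᵢ(t, s, ẑᵢ)`,
on the state space indexed by `(Σ i, Fin (m i)) ⊕ Fin n`. -/
noncomputable def blendField {N n : ℕ} {m : Fin N → ℕ}
    (g : (i : Fin N) → ℝ → (Fin (m i) → ℝ) → (Fin n → ℝ) → Fin (m i) → ℝ)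
    (h : (i : Fin N) → ℝ → (Fin n → ℝ) → (Fin (m i) → ℝ) → Fin n → ℝ)
    (t : ℝ) (p : ((Σ i : Fin N, Fin (m i)) ⊕ Fin n) → ℝ) :
    ((Σ i : Fin N, Fin (m i)) ⊕ Fin n) → ℝ :=
  Sum.elim
    (fun q : Σ i : Fin N, Fin (m i) =>
      g q.1 t (fun b => p (Sum.inl ⟨q.1, b⟩)) (fun j => p (Sum.inr j)) q.2)
    (fun j : Fin n =>
      ((N : ℝ)⁻¹ • ∑ i, h i t (fun j' => p (Sum.inr j')) (fun b => p (Sum.inl ⟨i, b⟩))) j)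

/-- Vector fields that are uniformly (in time) Lipschitz on bounded sets, bounded at the origin and
continuous in time. -/
structure GoodF {E F : Type*} [NormedAddCommGroup E] [NormedAddCommGroup F]
    (f : ℝ → E → F) : Prop where
  lip : ∀ R : ℝ, ∃ C : ℝ, 0 ≤ C ∧ ∀ t x y, ‖x‖ ≤ R → ‖y‖ ≤ R → ‖f t x - f t y‖ ≤ C * ‖x - y‖
  bdd0 : ∃ C : ℝ, ∀ t, ‖f t 0‖ ≤ C
  cont : ∀ x, Continuous fun t => f t x

namespace GoodF

variable {E F G : Type*} [NormedAddCommGroup E] [NormedAddCommGroup F] [NormedAddCommGroup G]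
  [NormedSpace ℝ E] [NormedSpace ℝ F] [NormedSpace ℝ G]

theorem bdd {f : ℝ → E → F} (hf : GoodF f) (R : ℝ) :
    ∃ C : ℝ, 0 ≤ C ∧ ∀ t x, ‖x‖ ≤ R → ‖f t x‖ ≤ C := by
  obtain ⟨L, hL0, hL⟩ := hf.lip R
  obtain ⟨C, hC⟩ := hf.bdd0
  have hC0 : 0 ≤ C := (norm_nonneg _).trans (hC 0)
  refine ⟨L * |R| + C, by positivity, fun t x hx => ?_⟩
  have hR : 0 ≤ R := (norm_nonneg _).trans hx
  have h1 := hL t x 0 hx (by simpa using hR)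
  have h2 : ‖f t x‖ ≤ ‖f t x - f t 0‖ + ‖f t 0‖ := norm_le_norm_sub_add _ _
  rw [sub_zero] at h1
  have h3 : L * ‖x‖ ≤ L * |R| := mul_le_mul_of_nonneg_left (hx.trans (le_abs_self _)) hL0
  linarith [hC t]

theorem add {f g : ℝ → E → F} (hf : GoodF f) (hg : GoodF g) :
    GoodF (fun t x => f t x + g t x) := by
  refine ⟨fun R => ?_, ?_, fun x => (hf.cont x).add (hg.cont x)⟩
  · obtain ⟨L, hL0, hL⟩ := hf.lip R
    obtain ⟨L', hL0', hL'⟩ := hg.lip R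
    refine ⟨L + L', by positivity, fun t x y hx hy => ?_⟩
    have : f t x + g t x - (f t y + g t y) = (f t x - f t y) + (g t x - g t y) := by abel
    rw [this, add_mul]
    exact (norm_add_le _ _).trans (add_le_add (hL t x y hx hy) (hL' t x y hx hy))
  · obtain ⟨C, hC⟩ := hf.bdd0
    obtain ⟨C', hC'⟩ := hg.bdd0
    exact ⟨C + C', fun t => (norm_add_le _ _).trans (add_le_add (hC t) (hC' t))⟩

theorem clm_comp {f : ℝ → E → F} (hf : GoodF f) (A : F →L[ℝ] G) :
    GoodF (fun t x => A (f t x)) := by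
  refine ⟨fun R => ?_, ?_, fun x => A.continuous.comp (hf.cont x)⟩
  · obtain ⟨L, hL0, hL⟩ := hf.lip R
    refine ⟨‖A‖ * L, by positivity, fun t x y hx hy => ?_⟩
    rw [← map_sub, mul_assoc]
    exact (A.le_opNorm _).trans (mul_le_mul_of_nonneg_left (hL t x y hx hy) (norm_nonneg _))
  · obtain ⟨C, hC⟩ := hf.bdd0
    exact ⟨‖A‖ * C, fun t => (A.le_opNorm _).trans
      (mul_le_mul_of_nonneg_left (hC t) (norm_nonneg _))⟩

theorem comp_clm {f : ℝ → F → G} (hf : GoodF f) (A : E →L[ℝ] F) :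
    GoodF (fun t x => f t (A x)) := by
  refine ⟨fun R => ?_, ?_, fun x => hf.cont (A x)⟩
  · obtain ⟨L, hL0, hL⟩ := hf.lip (‖A‖ * R)
    refine ⟨L * ‖A‖, by positivity, fun t x y hx hy => ?_⟩
    have h1 := hL t (A x) (A y)
      ((A.le_opNorm _).trans (mul_le_mul_of_nonneg_left hx (norm_nonneg _)))
      ((A.le_opNorm _).trans (mul_le_mul_of_nonneg_left hy (norm_nonneg _)))
    rw [← map_sub] at h1
    rw [mul_assoc]
    exact h1.trans (mul_le_mul_of_nonneg_left (A.le_opNorm _) hL0)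
  · obtain ⟨C, hC⟩ := hf.bdd0
    exact ⟨C, fun t => by simpa using hC t⟩

theorem of_clm (A : E →L[ℝ] F) : GoodF (fun (_ : ℝ) x => A x) := by
  refine ⟨fun R => ⟨‖A‖, norm_nonneg _, fun t x y _ _ => ?_⟩, ⟨0, by simp⟩,
    fun x => continuous_const⟩
  rw [← map_sub]
  exact A.le_opNorm _

theorem pi {ι : Type*} [Fintype ι] {f : ι → ℝ → E → ℝ} (hf : ∀ i, GoodF (f i)) :
    GoodF (fun t x i => f i t x) := by
  refine ⟨fun R => ?_, ?_, fun x => continuous_pi fun i => (hf i).cont x⟩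
  · choose L hL0 hL using fun i => (hf i).lip R
    refine ⟨∑ i, L i, Finset.sum_nonneg fun i _ => hL0 i, fun t x y hx hy => ?_⟩
    have h0 : 0 ≤ ∑ i, L i := Finset.sum_nonneg fun i _ => hL0 i
    rw [pi_norm_le_iff_of_nonneg (by positivity)]
    intro i
    refine (hL i t x y hx hy).trans (mul_le_mul_of_nonneg_right ?_ (norm_nonneg _))
    exact Finset.single_le_sum (fun i _ => hL0 i) (Finset.mem_univ i)
  · choose C hC using fun i => (hf i).bdd0
    have hC0 : ∀ i, 0 ≤ C i := fun i => (norm_nonneg _).trans (hC i 0)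
    refine ⟨∑ i, C i, fun t => ?_⟩
    rw [pi_norm_le_iff_of_nonneg (Finset.sum_nonneg fun i _ => hC0 i)]
    exact fun i => (hC i t).trans
      (Finset.single_le_sum (fun i _ => hC0 i) (Finset.mem_univ i))

end GoodF

theorem norm_le_eunorm {ι : Type*} [Fintype ι] (v : ι → ℝ) : ‖v‖ ≤ eunorm v := by
  unfold eunorm
  rw [pi_norm_le_iff_of_nonneg (Real.sqrt_nonneg _)]
  intro i
  rw [Real.norm_eq_abs]
  apply Real.abs_le_sqrt
  exact Finset.single_le_sum (f := fun j => v j ^ 2) (fun i _ => sq_nonneg _) (Finset.mem_univ i)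

theorem Reg2.good {d₁ d₂ d₃ : ℕ} {g : ℝ → (Fin d₁ → ℝ) → (Fin d₂ → ℝ) → Fin d₃ → ℝ}
    (hg : Reg2 g) : GoodF (fun t (p : (Fin d₁ → ℝ) × (Fin d₂ → ℝ)) => g t p.1 p.2) := by
  obtain ⟨hc, hd, hl, C, hC⟩ := hg
  refine ⟨fun R => ?_, ⟨C, fun t => (norm_le_eunorm _).trans (hC t)⟩, fun x => ?_⟩
  · choose L ε hε hL using hl
    obtain ⟨T, -, hT⟩ := (isCompact_closedBall (0 : (Fin d₁ → ℝ) × (Fin d₂ → ℝ)) R).elim_nhds_subcover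
      (fun p => Metric.ball p (ε p)) (fun p _ => Metric.ball_mem_nhds _ (hε p))
    have key : ∀ t, LipschitzOnWith (∑ p ∈ T, L p)
        (fun p : (Fin d₁ → ℝ) × (Fin d₂ → ℝ) => g t p.1 p.2) (Metric.closedBall 0 R) := by
      intro t
      refine (convex_closedBall _ _).lipschitzOnWith_of_nnnorm_fderiv_le (𝕜 := ℝ)
        (fun x _ => ((hd t).differentiable one_ne_zero).differentiableAt) ?_
      intro x hx
      obtain ⟨p, hpT, hp⟩ := Set.mem_iUnion₂.1 (hT hx)
      have := norm_fderiv_le_of_lipschitzOn ℝ (Metric.isOpen_ball.mem_nhds hp) (hL p t)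
      exact le_trans this (Finset.single_le_sum (f := L) (fun i _ => zero_le) hpT)
    refine ⟨(∑ p ∈ T, L p : NNReal), NNReal.coe_nonneg _, fun t x y hx hy => ?_⟩
    exact (key t).norm_sub_le (by simpa using hx) (by simpa using hy)
  · exact hc.comp (continuous_id.prodMk continuous_const)

/-- Global existence for globally Lipschitz bounded fields. -/
theorem global_exists {E : Type*} [NormedAddCommGroup E] [NormedSpace ℝ E] [CompleteSpace E]
    (f : ℝ → E → E) (L M : NNReal) (hL : ∀ t, LipschitzWith L (f t)) (hM : ∀ t x, ‖f t x‖ ≤ M)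
    (hc : ∀ x, Continuous fun t => f t x) (t₀ : ℝ) (x₀ : E) :
    ∃ x : ℝ → E, x t₀ = x₀ ∧ ∀ t, HasDerivAt x (f t (x t)) t := by
  have ex : ∀ n : ℕ, ∃ x : ℝ → E, x t₀ = x₀ ∧
      ∀ t ∈ Set.Ioo (t₀ - (n + 1)) (t₀ + (n + 1)), HasDerivAt x (f t (x t)) t := by
    intro n
    have hpl : IsPicardLindelof f (tmin := t₀ - (n + 1)) (tmax := t₀ + (n + 1))
        ⟨t₀, by constructor <;> linarith [(Nat.cast_nonneg n : (0:ℝ) ≤ n)]⟩ x₀ (M * (n + 1)) 0 M L :=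
      { lipschitzOnWith := fun t _ => (hL t).lipschitzOnWith
        continuousOn := fun x _ => (hc x).continuousOn
        norm_le := fun t _ x _ => hM t x
        mul_max_le := by simp }
    obtain ⟨x, h0, hx⟩ := hpl.exists_eq_forall_mem_Icc_hasDerivWithinAt₀
    exact ⟨x, h0, fun t ht => (hx t (Set.Ioo_subset_Icc_self ht)).hasDerivAt
      (Icc_mem_nhds ht.1 ht.2)⟩
  choose x h0 hx using ex
  have uniq : ∀ n k : ℕ, n ≤ k → Set.EqOn (x n) (x k) (Set.Ioo (t₀ - (n + 1)) (t₀ + (n + 1))) := by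
    intro n k hnk
    have hnk' : (n : ℝ) ≤ k := by exact_mod_cast hnk
    refine ODE_solution_unique_of_mem_Ioo (v := f) (s := fun _ => Set.univ) (K := L) (t₀ := t₀)
      (fun t _ => (hL t).lipschitzOnWith) ?_ (fun t ht => ⟨hx n t ht, trivial⟩)
      (fun t ht => ⟨hx k t ⟨by linarith [ht.1], by linarith [ht.2]⟩, trivial⟩) (by rw [h0, h0])
    constructor <;> linarith [(Nat.cast_nonneg n : (0:ℝ) ≤ n)]
  have hmem : ∀ t : ℝ, ∀ n : ℕ, |t - t₀| < n + 1 → t ∈ Set.Ioo (t₀ - ((n:ℝ) + 1)) (t₀ + (n + 1)) := by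
    intro t n h
    rw [abs_lt] at h
    constructor <;> linarith [h.1, h.2]
  have hfl : ∀ t : ℝ, |t - t₀| < (⌊|t - t₀|⌋₊ : ℝ) + 1 := fun t => Nat.lt_floor_add_one _
  refine ⟨fun t => x ⌊|t - t₀|⌋₊ t, by simp [h0], fun t => ?_⟩
  set n := ⌊|t - t₀|⌋₊ with hn
  have hev : (fun t => x ⌊|t - t₀|⌋₊ t) =ᶠ[nhds t] x n := by
    have h1 := isOpen_Ioo.mem_nhds (hmem t n (hfl t))
    filter_upwards [h1] with τ hτ
    have hle : ⌊|τ - t₀|⌋₊ ≤ n := by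
      have : |τ - t₀| < n + 1 := by
        rw [abs_lt]; constructor <;> linarith [hτ.1, hτ.2]
      have := (Nat.floor_lt (abs_nonneg _)).2 (by exact_mod_cast this : |τ - t₀| < ((n + 1 : ℕ) : ℝ))
      omega
    exact uniq _ _ hle (hmem _ _ (hfl τ))
  exact (hx n t (hmem t n (hfl t))).congr_of_eventuallyEq hev

/-- Coordinatewise clamp. -/
noncomputable def clampV {ι : Type*} (R : ℝ) (x : ι → ℝ) : ι → ℝ :=
  fun i => max (-R) (min R (x i))

theorem clampV_norm {ι : Type*} [Fintype ι] {R : ℝ} (hR : 0 ≤ R) (x : ι → ℝ) :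
    ‖clampV R x‖ ≤ R := by
  rw [pi_norm_le_iff_of_nonneg hR]
  intro i
  rw [Real.norm_eq_abs, abs_le]
  exact ⟨le_max_left _ _, max_le (by linarith) (min_le_left _ _)⟩

theorem clampV_eq {ι : Type*} [Fintype ι] {R : ℝ} (x : ι → ℝ) (hx : ‖x‖ ≤ R) :
    clampV R x = x := by
  funext i
  have h := (norm_le_pi_norm x i).trans hx
  rw [Real.norm_eq_abs, abs_le] at h
  simp [clampV, h.1, h.2]

theorem clampV_lip {ι : Type*} [Fintype ι] (R : ℝ) (x y : ι → ℝ) :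
    ‖clampV R x - clampV R y‖ ≤ ‖x - y‖ := by
  rw [pi_norm_le_iff_of_nonneg (norm_nonneg _)]
  intro i
  refine le_trans ?_ (norm_le_pi_norm (x - y) i)
  simp only [clampV, Pi.sub_apply, Real.norm_eq_abs]
  refine (abs_max_sub_max_le_max _ _ _ _).trans ?_
  simp only [sub_self, abs_zero]
  refine max_le (abs_nonneg _) ((abs_min_sub_min_le_max _ _ _ _).trans ?_)
  simp

/-- Global existence with a Lyapunov barrier. -/
theorem lyap_exists {ι : Type*} [Fintype ι] (f : ℝ → (ι → ℝ) → ι → ℝ) (hf : GoodF f)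
    (t₀ : ℝ) (x₀ : ι → ℝ) (R c : ℝ) (W : ℝ → (ι → ℝ) → ℝ) (W' : ℝ → (ι → ℝ) → (ι → ℝ) → ℝ)
    (hW : ∀ (x : ℝ → ι → ℝ) (v : ι → ℝ) (t : ℝ), t₀ ≤ t → HasDerivAt x v t →
      HasDerivAt (fun τ => W τ (x τ)) (W' t (x t) v) t)
    (hR : ∀ t x, t₀ ≤ t → W t x ≤ c → ‖x‖ ≤ R)
    (hneg : ∀ t x, t₀ ≤ t → W t x = c → W' t x (f t x) < 0)
    (h0 : W t₀ x₀ ≤ c) :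
    ∃ x : ℝ → ι → ℝ, x t₀ = x₀ ∧
      ∀ t, t₀ ≤ t → HasDerivAt x (f t (x t)) t ∧ W t (x t) ≤ c := by
  have hR0 : 0 ≤ R := (norm_nonneg _).trans (hR t₀ x₀ le_rfl h0)
  obtain ⟨L, hL0, hL⟩ := hf.lip R
  obtain ⟨M, hM0, hM⟩ := hf.bdd R
  obtain ⟨x, hx0, hx⟩ := global_exists (fun t x => f t (clampV R x)) ⟨L, hL0⟩ ⟨M, hM0⟩
    (fun t => LipschitzWith.of_dist_le_mul fun a b => by
      rw [dist_eq_norm, dist_eq_norm]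
      refine (hL t _ _ (clampV_norm hR0 _) (clampV_norm hR0 _)).trans ?_
      exact mul_le_mul_of_nonneg_left (clampV_lip _ _ _) hL0)
    (fun t x => hM t _ (clampV_norm hR0 _)) (fun x => hf.cont _) t₀ x₀
  have hle : ∀ t, t₀ ≤ t → W t (x t) ≤ c := by
    intro t ht
    refine image_le_of_deriv_right_lt_deriv_boundary (f := fun τ => W τ (x τ)) (a := t₀) (b := t)
      (f' := fun τ => W' τ (x τ) (f τ (clampV R (x τ)))) (B := fun _ => c) (B' := fun _ => 0)
      ?_ ?_ (by simpa [hx0] using h0) (fun _ => hasDerivAt_const _ _) ?_ ⟨ht, le_rfl⟩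
    · exact fun τ hτ => (hW x _ τ hτ.1 (hx τ)).continuousAt.continuousWithinAt
    · exact fun τ hτ => (hW x _ τ hτ.1 (hx τ)).hasDerivWithinAt
    · intro τ hτ h
      rw [clampV_eq _ (hR τ _ hτ.1 h.le)]
      exact hneg τ _ hτ.1 h
  refine ⟨x, hx0, fun t ht => ⟨?_, hle t ht⟩⟩
  have := hx t
  rwa [clampV_eq _ (hR t _ ht (hle t ht))] at this

theorem hasDerivAt_dot {ι : Type*} [Fintype ι] {x y : ℝ → ι → ℝ} {x' y' : ι → ℝ} {t : ℝ}
    (hx : HasDerivAt x x' t) (hy : HasDerivAt y y' t) :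
    HasDerivAt (fun τ => x τ ⬝ᵥ y τ) (x' ⬝ᵥ y t + x t ⬝ᵥ y') t := by
  unfold dotProduct
  rw [← Finset.sum_add_distrib]
  exact HasDerivAt.fun_sum fun i _ => (hasDerivAt_pi.1 hx i).mul (hasDerivAt_pi.1 hy i)

theorem hasDerivAt_mulVec {ι : Type*} [Fintype ι] (A : Matrix ι ι ℝ) {x : ℝ → ι → ℝ}
    {x' : ι → ℝ} {t : ℝ} (hx : HasDerivAt x x' t) :
    HasDerivAt (fun τ => A *ᵥ x τ) (A *ᵥ x') t :=
  (LinearMap.toContinuousLinearMap A.mulVecLin).hasFDerivAt.comp_hasDerivAt t hx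

theorem symm_dot {ι : Type*} [Fintype ι] {A : Matrix ι ι ℝ} (hA : A.PosDef) (x y : ι → ℝ) :
    x ⬝ᵥ A *ᵥ y = y ⬝ᵥ A *ᵥ x := by
  have h : Aᵀ = A := by
    have := hA.1
    rwa [Matrix.IsHermitian, Matrix.conjTranspose_eq_transpose_of_trivial] at this
  rw [Matrix.dotProduct_mulVec, ← Matrix.mulVec_transpose, h, dotProduct_comm]

theorem hasDerivAt_quad {ι : Type*} [Fintype ι] {A : Matrix ι ι ℝ} (hA : A.PosDef)
    {x : ℝ → ι → ℝ} {x' : ι → ℝ} {t : ℝ} (hx : HasDerivAt x x' t) :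
    HasDerivAt (fun τ => x τ ⬝ᵥ A *ᵥ x τ) (2 * (x t ⬝ᵥ A *ᵥ x')) t := by
  have := hasDerivAt_dot hx (hasDerivAt_mulVec A hx)
  rwa [symm_dot hA x' (x t), ← two_mul] at this

theorem norm_sq_le_dot {ι : Type*} [Fintype ι] (x : ι → ℝ) : ‖x‖ ^ 2 ≤ x ⬝ᵥ x := by
  have h := norm_le_eunorm x
  have h2 : x ⬝ᵥ x = ∑ j, x j ^ 2 := by simp [dotProduct, sq]
  have h3 : eunorm x ^ 2 = x ⬝ᵥ x := by
    rw [h2, eunorm, Real.sq_sqrt (Finset.sum_nonneg fun _ _ => sq_nonneg _)]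
  rw [← h3]
  exact pow_le_pow_left₀ (norm_nonneg _) h 2

theorem dot_le_norm_sq {ι : Type*} [Fintype ι] (x : ι → ℝ) :
    x ⬝ᵥ x ≤ (Fintype.card ι : ℝ) * ‖x‖ ^ 2 := by
  unfold dotProduct
  calc ∑ i, x i * x i ≤ ∑ _i : ι, ‖x‖ ^ 2 := by
        refine Finset.sum_le_sum fun i _ => ?_
        have h := norm_le_pi_norm x i
        rw [Real.norm_eq_abs] at h
        nlinarith [abs_nonneg (x i), abs_mul_abs_self (x i)]
    _ = _ := by simp

theorem dot_self_nonneg' {ι : Type*} [Fintype ι] (x : ι → ℝ) : 0 ≤ x ⬝ᵥ x :=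
  (sq_nonneg _).trans (norm_sq_le_dot x)

theorem two_dot_le {ι : Type*} [Fintype ι] (x y : ι → ℝ) {r : ℝ} (hr : 0 < r) :
    2 * (x ⬝ᵥ y) ≤ r * (x ⬝ᵥ x) + r⁻¹ * (y ⬝ᵥ y) := by
  unfold dotProduct
  rw [Finset.mul_sum, Finset.mul_sum, Finset.mul_sum, ← Finset.sum_add_distrib]
  refine Finset.sum_le_sum fun i _ => ?_
  have h : r * (x i * x i) + r⁻¹ * (y i * y i) - 2 * (x i * y i) = r⁻¹ * (r * x i - y i) ^ 2 := by
    field_simp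
    ring
  have : 0 ≤ r⁻¹ * (r * x i - y i) ^ 2 := by positivity
  linarith

/-- Comparison of two homogeneous quadratic functions by compactness. -/
theorem quad_compare {E : Type*} [NormedAddCommGroup E] [NormedSpace ℝ E] [FiniteDimensional ℝ E]
    (S : Submodule ℝ E) (P Q : E → ℝ) (hP : Continuous P) (hQ : Continuous Q)
    (hP2 : ∀ (r : ℝ) v, P (r • v) = r ^ 2 * P v) (hQ2 : ∀ (r : ℝ) v, Q (r • v) = r ^ 2 * Q v)
    (hpos : ∀ v ∈ S, v ≠ 0 → 0 < Q v) :
    ∃ c > 0, ∀ v ∈ S, c * P v ≤ Q v := by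
  have hcomp : IsCompact (Metric.sphere (0 : E) 1 ∩ (S : Set E)) :=
    (isCompact_sphere (0 : E) 1).inter_right S.closed_of_finiteDimensional
  have hP0 : P 0 = 0 := by simpa using hP2 0 0
  have hQ0 : Q 0 = 0 := by simpa using hQ2 0 0
  obtain ⟨p, hp⟩ := hcomp.bddAbove_image hP.continuousOn
  have key : ∃ q > 0, ∀ v ∈ Metric.sphere (0 : E) 1 ∩ (S : Set E), q ≤ Q v := by
    rcases (Metric.sphere (0 : E) 1 ∩ (S : Set E)).eq_empty_or_nonempty with he | hne
    · exact ⟨1, one_pos, by simp [he]⟩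
    · obtain ⟨v, hv, hmin⟩ := hcomp.exists_isMinOn hne hQ.continuousOn
      refine ⟨Q v, hpos v hv.2 ?_, fun w hw => hmin hw⟩
      rintro rfl
      simpa using hv.1
  obtain ⟨q, hq, hq'⟩ := key
  refine ⟨q / (|p| + 1), by positivity, fun v hv => ?_⟩
  by_cases hv0 : v = 0
  · simp [hv0, hP0, hQ0]
  have hn : ‖v‖ ≠ 0 := norm_ne_zero_iff.2 hv0
  have hw : ‖v‖⁻¹ • v ∈ Metric.sphere (0 : E) 1 ∩ (S : Set E) :=
    ⟨by simp [norm_smul, hn], S.smul_mem _ hv⟩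
  have h1 : P (‖v‖⁻¹ • v) ≤ p := hp ⟨_, hw, rfl⟩
  have h2 := hq' _ hw
  rw [hP2] at h1
  rw [hQ2] at h2
  have hpos2 : 0 < (‖v‖⁻¹) ^ 2 := by positivity
  have h3 : q / (|p| + 1) * ((‖v‖⁻¹) ^ 2 * P v) ≤ q := by
    rw [div_mul_eq_mul_div, div_le_iff₀ (by positivity)]
    exact mul_le_mul_of_nonneg_left (by linarith [le_abs_self p]) hq.le
  have h4 : (‖v‖⁻¹) ^ 2 * (q / (|p| + 1) * P v) ≤ (‖v‖⁻¹) ^ 2 * Q v := by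
    linarith
  exact le_of_mul_le_mul_left h4 hpos2

theorem continuous_quad {ι : Type*} [Fintype ι] (A : Matrix ι ι ℝ) :
    Continuous fun x : ι → ℝ => x ⬝ᵥ A *ᵥ x := by
  unfold dotProduct mulVec dotProduct
  fun_prop

theorem continuous_dot {ι : Type*} [Fintype ι] :
    Continuous fun x : ι → ℝ => x ⬝ᵥ x := by
  unfold dotProduct
  fun_prop

theorem posdef_bounds {ι : Type*} [Fintype ι] {A : Matrix ι ι ℝ} (hA : A.PosDef) :
    ∃ l > 0, ∃ u > 0, ∀ x : ι → ℝ, l * (x ⬝ᵥ x) ≤ x ⬝ᵥ A *ᵥ x ∧ u * (x ⬝ᵥ A *ᵥ x) ≤ x ⬝ᵥ x := by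
  have h1 : ∀ (r : ℝ) (v : ι → ℝ), (r • v) ⬝ᵥ (r • v) = r ^ 2 * (v ⬝ᵥ v) := by
    intro r v; simp [smul_dotProduct, dotProduct_smul]; ring
  have h2 : ∀ (r : ℝ) (v : ι → ℝ), (r • v) ⬝ᵥ A *ᵥ (r • v) = r ^ 2 * (v ⬝ᵥ A *ᵥ v) := by
    intro r v; simp [smul_dotProduct, dotProduct_smul, Matrix.mulVec_smul]; ring
  obtain ⟨l, hl, hl'⟩ := quad_compare (⊤ : Submodule ℝ (ι → ℝ)) _ _ continuous_dot
    (continuous_quad A) h1 h2 (fun v _ hv => by simpa using hA.dotProduct_mulVec_pos hv)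
  obtain ⟨u, hu, hu'⟩ := quad_compare (⊤ : Submodule ℝ (ι → ℝ)) _ _ 
    (continuous_quad A) continuous_dot h2 h1 (fun v _ hv => by
      refine lt_of_lt_of_le ?_ (norm_sq_le_dot v)
      have := norm_pos_iff.2 hv
      positivity)
  exact ⟨l, hl, u, hu, fun x => ⟨hl' x trivial, hu' x trivial⟩⟩

theorem contr_ineq {ι : Type*} [Fintype ι] [DecidableEq ι] {F : ℝ → (ι → ℝ) → ι → ℝ}
    {Θ : Matrix ι ι ℝ} (hΘ : Θ.PosDef)
    (h : ∀ (t : ℝ) (s : ι → ℝ), ∃ J : Matrix ι ι ℝ,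
      HasFDerivAt (F t) (LinearMap.toContinuousLinearMap J.mulVecLin) s ∧
      (-1 - (Θ * J + Jᵀ * Θ) : Matrix ι ι ℝ).PosSemidef) (t : ℝ) (x y : ι → ℝ) :
    2 * ((x - y) ⬝ᵥ Θ *ᵥ (F t x - F t y)) ≤ - ((x - y) ⬝ᵥ (x - y)) := by
  choose J hJ hneg using h t
  set e := x - y with he
  have hcurve : ∀ τ : ℝ, HasDerivAt (fun τ : ℝ => y + τ • e) e τ := by
    intro τ
    simpa using ((hasDerivAt_id τ).smul_const e).const_add y
  have hφ : ∀ τ : ℝ, HasDerivAt (fun τ : ℝ => 2 * (e ⬝ᵥ Θ *ᵥ (F t (y + τ • e))))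
      (2 * (e ⬝ᵥ Θ *ᵥ (J (y + τ • e) *ᵥ e))) τ := by
    intro τ
    have h1 : HasDerivAt (fun τ : ℝ => F t (y + τ • e)) (J (y + τ • e) *ᵥ e) τ := by
      have := HasFDerivAt.comp_hasDerivAt (l := F t) τ (hJ (y + τ • e)) (hcurve τ)
      exact this
    have h2 := hasDerivAt_dot (hasDerivAt_const τ e) (hasDerivAt_mulVec Θ h1)
    simpa using h2.const_mul 2
  have hb : ∀ s, 2 * (e ⬝ᵥ Θ *ᵥ (J s *ᵥ e)) ≤ - (e ⬝ᵥ e) := by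
    intro s
    have h1 := (hneg s).dotProduct_mulVec_nonneg e
    have h2 : e ⬝ᵥ ((J s)ᵀ * Θ) *ᵥ e = e ⬝ᵥ Θ *ᵥ (J s *ᵥ e) := by
      rw [← Matrix.mulVec_mulVec, Matrix.dotProduct_mulVec, Matrix.vecMul_transpose,
        symm_dot hΘ]
    simp only [star_trivial, Matrix.sub_mulVec, Matrix.neg_mulVec, Matrix.one_mulVec,
      Matrix.add_mulVec, dotProduct_sub, dotProduct_add, dotProduct_neg, h2] at h1
    rw [← Matrix.mulVec_mulVec] at h1
    linarith
  obtain ⟨ξ, -, hξ⟩ := exists_hasDerivAt_eq_slope _ _ (zero_lt_one (α := ℝ))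
    (fun τ _ => (hφ τ).continuousAt.continuousWithinAt) (fun τ _ => hφ τ)
  have h5 := hb (y + ξ • e)
  rw [hξ] at h5
  have h6 : y + e = x := by rw [he]; abel
  simp only [one_smul, zero_smul, add_zero, h6, sub_zero, div_one] at h5
  rw [Matrix.mulVec_sub, dotProduct_sub]
  linarith

/-- Bounded global solutions of contractive systems. -/
theorem contr_exists {ι : Type*} [Fintype ι] [DecidableEq ι] {F : ℝ → (ι → ℝ) → ι → ℝ}
    (hF : GoodF F) {Θ : Matrix ι ι ℝ} (hΘ : Θ.PosDef)
    (h : ∀ t x y, 2 * ((x - y) ⬝ᵥ Θ *ᵥ (F t x - F t y)) ≤ - ((x - y) ⬝ᵥ (x - y)))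
    (t₀ R₁ : ℝ) : ∃ R₂ : ℝ, ∀ v₀ : ι → ℝ, ‖v₀‖ ≤ R₁ → ∃ v : ℝ → ι → ℝ, v t₀ = v₀ ∧
      ∀ t, t₀ ≤ t → HasDerivAt v (F t (v t)) t ∧ ‖v t‖ ≤ R₂ := by
  obtain ⟨l, hl, u, hu, hlu⟩ := posdef_bounds hΘ
  obtain ⟨C, hC⟩ := (hF.clm_comp (LinearMap.toContinuousLinearMap Θ.mulVecLin)).bdd0
  have hC' : ∀ t, ‖Θ *ᵥ F t 0‖ ≤ C := hC
  set b : ℝ := 2 * (Fintype.card ι * C ^ 2) with hb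
  have hb0 : 0 ≤ b := by positivity
  set c : ℝ := Fintype.card ι * R₁ ^ 2 / u + 2 * b / u + 1 with hc
  have hcpos : 0 < c := by positivity
  have hball : ∀ x : ι → ℝ, x ⬝ᵥ Θ *ᵥ x ≤ c → ‖x‖ ≤ Real.sqrt (c / l) := by
    intro x hx
    apply Real.le_sqrt_of_sq_le
    rw [le_div_iff₀ hl]
    nlinarith [norm_sq_le_dot x, (hlu x).1]
  refine ⟨Real.sqrt (c / l), fun v₀ hv₀ => ?_⟩
  have hneg : ∀ t (x : ι → ℝ), t₀ ≤ t → x ⬝ᵥ Θ *ᵥ x = c → 2 * (x ⬝ᵥ Θ *ᵥ F t x) < 0 := by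
    intro t x _ hx
    have h1 := h t x 0
    rw [sub_zero, Matrix.mulVec_sub, dotProduct_sub] at h1
    have h2 := two_dot_le x (Θ *ᵥ F t 0) (r := 1 / 2) (by norm_num)
    have h3 := dot_le_norm_sq (Θ *ᵥ F t 0)
    have h4 : ‖Θ *ᵥ F t 0‖ ^ 2 ≤ C ^ 2 := pow_le_pow_left₀ (norm_nonneg _) (hC' t) 2
    have h5 : (Fintype.card ι : ℝ) * ‖Θ *ᵥ F t 0‖ ^ 2 ≤ Fintype.card ι * C ^ 2 := by gcongr
    have h6 := (hlu x).2
    rw [hx] at h6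
    have h7 : 2 * b < u * c := by
      rw [hc]
      have : u * (Fintype.card ι * R₁ ^ 2 / u + 2 * b / u + 1)
        = Fintype.card ι * R₁ ^ 2 + 2 * b + u := by field_simp
      rw [this]
      have : 0 ≤ (Fintype.card ι : ℝ) * R₁ ^ 2 := by positivity
      linarith
    norm_num at h2
    linarith
  have hinit : v₀ ⬝ᵥ Θ *ᵥ v₀ ≤ c := by
    have h6 := (hlu v₀).2
    have h7 := dot_le_norm_sq v₀
    have h8 : (Fintype.card ι : ℝ) * ‖v₀‖ ^ 2 ≤ Fintype.card ι * R₁ ^ 2 := by gcongr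
    have h9 : v₀ ⬝ᵥ Θ *ᵥ v₀ ≤ Fintype.card ι * R₁ ^ 2 / u := by
      rw [le_div_iff₀ hu]; linarith
    have : 0 ≤ 2 * b / u := by positivity
    linarith
  obtain ⟨v, hv0, hv⟩ := lyap_exists F hF t₀ v₀ (Real.sqrt (c / l)) c
    (fun _ x => x ⬝ᵥ Θ *ᵥ x) (fun _ x v => 2 * (x ⬝ᵥ Θ *ᵥ v))
    (fun x v t _ hx => hasDerivAt_quad hΘ hx) (fun t x _ hx => hball x hx) hneg hinit
  exact ⟨v, hv0, fun t ht => ⟨(hv t ht).1, hball _ (hv t ht).2⟩⟩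

theorem decay_lemma {u u' : ℝ → ℝ} {t₀ κ b : ℝ} (hκ : 0 < κ)
    (hu : ∀ t, t₀ ≤ t → HasDerivAt u (u' t) t) (hb : ∀ t, t₀ ≤ t → u' t ≤ -κ * u t + b)
    {ε : ℝ} (hε : 0 < ε) : ∃ T, t₀ ≤ T ∧ ∀ t, T ≤ t → u t ≤ b / κ + ε := by
  have hE : ∀ t, HasDerivAt (fun τ => Real.exp (κ * (τ - t₀))) (Real.exp (κ * (t - t₀)) * κ) t := by
    intro t
    have := (((hasDerivAt_id t).sub_const t₀).const_mul κ).exp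
    simpa using this
  have hle : ∀ t, t₀ ≤ t → Real.exp (κ * (t - t₀)) * (u t - b / κ) ≤ u t₀ - b / κ := by
    intro t ht
    have hd : ∀ τ, t₀ ≤ τ → HasDerivAt (fun τ => Real.exp (κ * (τ - t₀)) * (u τ - b / κ))
        (Real.exp (κ * (τ - t₀)) * κ * (u τ - b / κ) + Real.exp (κ * (τ - t₀)) * u' τ) τ :=
      fun τ hτ => (hE τ).mul ((hu τ hτ).sub_const _)
    refine image_le_of_deriv_right_le_deriv_boundary
      (f := fun τ => Real.exp (κ * (τ - t₀)) * (u τ - b / κ)) (a := t₀) (b := t)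
      (B := fun _ => u t₀ - b / κ) (B' := fun _ => 0)
      (fun τ hτ => (hd τ hτ.1).continuousAt.continuousWithinAt)
      (fun τ hτ => (hd τ hτ.1).hasDerivWithinAt) (by simp) continuousOn_const
      (fun _ _ => hasDerivWithinAt_const _ _ _) ?_ ⟨ht, le_rfl⟩
    intro τ hτ
    have h1 := hb τ hτ.1
    have h2 : κ * (u τ - b / κ) + u' τ ≤ 0 := by
      have : κ * (b / κ) = b := by field_simp
      nlinarith
    have h3 := Real.exp_pos (κ * (τ - t₀))
    nlinarith
  have hlim : Tendsto (fun t => Real.exp (-(κ * (t - t₀))) * (u t₀ - b / κ)) atTop (nhds 0) := by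
    have h1 : Tendsto (fun t : ℝ => κ * (t - t₀)) atTop atTop :=
      (tendsto_atTop_add_const_right _ (-t₀) tendsto_id).const_mul_atTop hκ
    simpa using (Real.tendsto_exp_neg_atTop_nhds_zero.comp h1).mul_const (u t₀ - b / κ)
  obtain ⟨T, hT⟩ := eventually_atTop.1 (hlim.eventually (gt_mem_nhds hε))
  refine ⟨max T t₀, le_max_right _ _, fun t ht => ?_⟩
  have h1 := hT t ((le_max_left _ _).trans ht)
  have h2 := hle t ((le_max_right _ _).trans ht)
  have h3 : Real.exp (-(κ * (t - t₀))) * (Real.exp (κ * (t - t₀)) * (u t - b / κ))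
      ≤ Real.exp (-(κ * (t - t₀))) * (u t₀ - b / κ) :=
    mul_le_mul_of_nonneg_left h2 (Real.exp_pos _).le
  rw [← mul_assoc, ← Real.exp_add, neg_add_cancel, Real.exp_zero, one_mul] at h3
  linarith

theorem le_of_sq_le_sq' {a b : ℝ} (h : a ^ 2 ≤ b ^ 2) (hb : 0 ≤ b) : a ≤ b :=
  (le_abs_self a).trans (abs_le_of_sq_le_sq h hb)

set_option maxHeartbeats 4000000 in
/-- Abstract form of the practical synchronization theorem. -/
theorem abstract_sync {ι κ' : Type*} [Fintype ι] [Fintype κ'] [DecidableEq κ']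
    (f : ℝ → (ι → ℝ) → ι → ℝ) (hf : GoodF f)
    (Cp : (ι → ℝ) →L[ℝ] (ι → ℝ)) (p : (ι → ℝ) →L[ℝ] (κ' → ℝ)) (q : (κ' → ℝ) →L[ℝ] (ι → ℝ))
    (hpC : ∀ x, p (Cp x) = 0) (c : ℝ) (hc : 0 < c)
    (hdiss : ∀ x, (x - q (p x)) ⬝ᵥ Cp x ≤ -c * ((x - q (p x)) ⬝ᵥ (x - q (p x))))
    (hcontr : Contractive (fun t v => p (f t (q v))))
    (t₀ R₀ η : ℝ) (hη : 0 < η) :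
    ∃ kstar > (0 : ℝ), ∀ k > kstar, ∀ x₀ : ι → ℝ, ‖x₀‖ ≤ R₀ →
      ∃ (x : ℝ → ι → ℝ) (v : ℝ → κ' → ℝ), x t₀ = x₀ ∧ v t₀ = p x₀ ∧
        (∀ t, t₀ ≤ t → HasDerivAt x (f t (x t) + k • Cp (x t)) t) ∧
        (∀ t, t₀ ≤ t → HasDerivAt v (p (f t (q (v t)))) t) ∧
        ∃ T, ∀ t, T ≤ t → ‖x t - q (v t)‖ ≤ η := by
  obtain ⟨Θ, hΘ, hJ⟩ := hcontr
  have hin := contr_ineq hΘ hJ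
  have hFg : GoodF (fun t v => p (f t (q v))) := (hf.comp_clm q).clm_comp p
  obtain ⟨R₂, hR₂⟩ := contr_exists hFg hΘ hin t₀ (‖p‖ * R₀)
  obtain ⟨l, hl, u, hu, hlu⟩ := posdef_bounds hΘ
  set D : (ι → ℝ) →L[ℝ] (ι → ℝ) := ContinuousLinearMap.id ℝ _ - q.comp p with hD
  have hDx : ∀ x, D x = x - q (p x) := fun x => rfl
  set u0 : ℝ := Fintype.card ι * (‖D‖ * R₀) ^ 2 with hu0
  have hu0n : 0 ≤ u0 := by positivity
  set r : ℝ := Real.sqrt (1 / l) with hr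
  set R₃ : ℝ := ‖q‖ * (R₂ + r) + (u0 + 1) with hR₃
  obtain ⟨L, hL0, hL⟩ :=
    ((hf.clm_comp p).clm_comp (LinearMap.toContinuousLinearMap Θ.mulVecLin)).lip R₃
  obtain ⟨M₀, hM₀, hM₀'⟩ := (hf.clm_comp D).bdd R₃
  set B : ℝ := 2 * (Fintype.card κ' * L ^ 2) + 1 with hB
  have hBpos : 0 < B := by positivity
  set M : ℝ := Fintype.card ι * M₀ ^ 2 with hM
  have hMn : 0 ≤ M := by positivity
  set a : ℝ := u / 2 with ha
  have hapos : 0 < a := by positivity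
  set σ : ℝ := l * (η / 2) ^ 2 / (‖q‖ + 1) ^ 2 with hσ
  have hσpos : 0 < σ := by positivity
  set S : ℝ := 2 * a + M / a + 2 * B * (u0 + 1) * (1 + 1 / σ) + 8 * M / η ^ 2 + 1 with hS
  have e1 : 0 ≤ M / a := by positivity
  have e2 : 0 ≤ 2 * B * (u0 + 1) := by positivity
  have e2' : 0 ≤ 2 * B * (u0 + 1) * (1 / σ) := by positivity
  have e2'' : 2 * B * (u0 + 1) * (1 + 1 / σ) = 2 * B * (u0 + 1) + 2 * B * (u0 + 1) * (1 / σ) := by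
    ring
  have e3 : 0 ≤ 8 * M / η ^ 2 := by positivity
  refine ⟨S / c, by positivity, fun k hk x₀ hx₀ => ?_⟩
  set κ : ℝ := k * c with hκ
  have hκS : S < κ := by rwa [gt_iff_lt, div_lt_iff₀ hc] at hk
  have hκ1 : 1 < κ := by linarith
  have hκpos : 0 < κ := by linarith
  have hkpos : 0 < k := by
    have : 0 < S / c := by positivity
    linarith
  have hκa : 2 * a ≤ κ := by linarith
  have hκM : M < a * κ := by
    have : M / a < κ := by linarith
    rw [div_lt_iff₀ hapos] at this
    linarith
  have hκη : M / κ ≤ η ^ 2 / 8 := by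
    have : 8 * M / η ^ 2 ≤ κ := by linarith
    rw [div_le_iff₀ (by positivity)] at this
    rw [div_le_iff₀ hκpos]
    linarith
  set cW : ℝ := 2 * B / κ * (u0 + 1) with hcW
  have hcWeq : cW = 2 * B * (u0 + 1) / κ := by rw [hcW]; ring
  have hcW1 : cW ≤ 1 := by
    rw [hcWeq, div_le_one hκpos]; linarith
  have hcWσ : cW ≤ σ := by
    rw [hcWeq, div_le_iff₀ hκpos]
    have h1 : 2 * B * (u0 + 1) * (1 / σ) ≤ κ := by linarith
    rw [mul_one_div, div_le_iff₀ hσpos] at h1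
    linarith
  have hBκ : 0 < 2 * B / κ := by positivity
  obtain ⟨v, hv0, hv⟩ := hR₂ (p x₀) ((p.le_opNorm _).trans (by gcongr))
  have hVn : ∀ e : κ' → ℝ, 0 ≤ e ⬝ᵥ Θ *ᵥ e := fun e =>
    le_trans (mul_nonneg hl.le (dot_self_nonneg' e)) (hlu e).1
  -- consequences of being inside the tube
  have htube : ∀ t x, (p x - v t) ⬝ᵥ Θ *ᵥ (p x - v t) + 2 * B / κ * (D x ⬝ᵥ D x) ≤ cW →
      (p x - v t) ⬝ᵥ Θ *ᵥ (p x - v t) ≤ cW ∧ D x ⬝ᵥ D x ≤ u0 + 1 := by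
    intro t x h
    have h1 := hVn (p x - v t)
    have h2 : 0 ≤ 2 * B / κ * (D x ⬝ᵥ D x) := mul_nonneg hBκ.le (dot_self_nonneg' _)
    refine ⟨by linarith, ?_⟩
    have h3 : 2 * B / κ * (D x ⬝ᵥ D x) ≤ 2 * B / κ * (u0 + 1) := by linarith
    exact le_of_mul_le_mul_left h3 hBκ
  have hball : ∀ t x, t₀ ≤ t →
      (p x - v t) ⬝ᵥ Θ *ᵥ (p x - v t) + 2 * B / κ * (D x ⬝ᵥ D x) ≤ cW →
      ‖x‖ ≤ R₃ ∧ ‖q (p x)‖ ≤ R₃ := by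
    intro t x ht h
    obtain ⟨h1, h2⟩ := htube t x h
    have h3 : ‖p x - v t‖ ≤ r := by
      apply Real.le_sqrt_of_sq_le
      rw [le_div_iff₀ hl]
      have h8 := mul_le_mul_of_nonneg_left (norm_sq_le_dot (p x - v t)) hl.le
      have h9 := (hlu (p x - v t)).1
      linarith
    have h4 : ‖p x‖ ≤ R₂ + r := by
      have := norm_le_norm_sub_add (p x) (v t)
      linarith [(hv t ht).2]
    have h5 : ‖q (p x)‖ ≤ ‖q‖ * (R₂ + r) := (q.le_opNorm _).trans (by gcongr)
    have h6 : ‖D x‖ ≤ u0 + 1 := by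
      refine le_of_sq_le_sq' ?_ (by linarith)
      have h8 := norm_sq_le_dot (D x)
      have h9 : u0 + 1 ≤ (u0 + 1) ^ 2 := le_self_pow₀ (by linarith) two_ne_zero
      linarith
    have h7 : ‖x‖ ≤ ‖x - q (p x)‖ + ‖q (p x)‖ := norm_le_norm_sub_add _ _
    rw [← hDx] at h7
    exact ⟨by linarith, by linarith⟩
  -- dissipation of the disagreement
  have hU : ∀ t x, ‖x‖ ≤ R₃ →
      2 * (D x ⬝ᵥ D (f t x + k • Cp x)) ≤ -κ * (D x ⬝ᵥ D x) + M / κ := by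
    intro t x hx
    have h1 : D (Cp x) = Cp x := by rw [hDx, hpC, map_zero, sub_zero]
    rw [map_add, map_smul, h1, dotProduct_add, dotProduct_smul, smul_eq_mul]
    have h2 := hdiss x
    rw [← hDx] at h2
    have h3 : k * (D x ⬝ᵥ Cp x) ≤ k * (-c * (D x ⬝ᵥ D x)) := mul_le_mul_of_nonneg_left h2 hkpos.le
    have h4 := two_dot_le (D x) (D (f t x)) hκpos
    have h5 : D (f t x) ⬝ᵥ D (f t x) ≤ M := by
      refine (dot_le_norm_sq _).trans ?_
      have := hM₀' t x hx
      rw [hM]; gcongr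
    have h6 : κ⁻¹ * (D (f t x) ⬝ᵥ D (f t x)) ≤ M / κ := by
      rw [div_eq_inv_mul]; gcongr
    have h7 : k * (-c * (D x ⬝ᵥ D x)) = -κ * (D x ⬝ᵥ D x) := by rw [hκ]; ring
    linarith
  have hV : ∀ t x, ‖x‖ ≤ R₃ → ‖q (p x)‖ ≤ R₃ →
      2 * ((p x - v t) ⬝ᵥ Θ *ᵥ (p (f t x + k • Cp x) - p (f t (q (v t)))))
        ≤ -a * ((p x - v t) ⬝ᵥ Θ *ᵥ (p x - v t)) + B * (D x ⬝ᵥ D x) := by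
    intro t x hx hx'
    rw [map_add, map_smul, hpC, smul_zero, add_zero]
    set e := p x - v t with he
    have h1 := hin t (p x) (v t)
    rw [← he] at h1
    have h2 : Θ *ᵥ (p (f t x) - p (f t (q (v t)))) = Θ *ᵥ (p (f t (q (p x))) - p (f t (q (v t))))
        + (Θ *ᵥ p (f t x) - Θ *ᵥ p (f t (q (p x)))) := by
      rw [Matrix.mulVec_sub, Matrix.mulVec_sub]; abel
    rw [h2, dotProduct_add]
    have h3 := hL t x (q (p x)) hx hx'
    have h3' : ‖Θ *ᵥ p (f t x) - Θ *ᵥ p (f t (q (p x)))‖ ≤ L * ‖D x‖ := h3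
    set w := Θ *ᵥ p (f t x) - Θ *ᵥ p (f t (q (p x))) with hw
    have h4 := two_dot_le e w (r := 1 / 2) (by norm_num)
    have h5 : w ⬝ᵥ w ≤ Fintype.card κ' * L ^ 2 * (D x ⬝ᵥ D x) := by
      refine (dot_le_norm_sq _).trans ?_
      rw [mul_assoc]
      gcongr
      calc ‖w‖ ^ 2 ≤ (L * ‖D x‖) ^ 2 := by gcongr
        _ = L ^ 2 * ‖D x‖ ^ 2 := by ring
        _ ≤ _ := by gcongr; exact norm_sq_le_dot _
    have h6 := (hlu e).2
    have h7 := dot_self_nonneg' (D x)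
    norm_num at h4
    rw [hB, ha]
    linarith
  -- barrier
  have hfk : GoodF (fun t x => f t x + k • Cp x) := hf.add (GoodF.of_clm (k • Cp))
  have hder : ∀ (x : ℝ → ι → ℝ) (w : ι → ℝ) (t : ℝ), t₀ ≤ t → HasDerivAt x w t →
      HasDerivAt (fun τ => (p (x τ) - v τ) ⬝ᵥ Θ *ᵥ (p (x τ) - v τ)
        + 2 * B / κ * (D (x τ) ⬝ᵥ D (x τ)))
        (2 * ((p (x t) - v t) ⬝ᵥ Θ *ᵥ (p w - p (f t (q (v t)))))
          + 2 * B / κ * (2 * (D (x t) ⬝ᵥ D w))) t := by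
    intro x w t ht hx
    have h1 : HasDerivAt (fun τ => p (x τ) - v τ) (p w - p (f t (q (v t)))) t :=
      (p.hasFDerivAt.comp_hasDerivAt t hx).sub (hv t ht).1
    have h2 : HasDerivAt (fun τ => D (x τ)) (D w) t := D.hasFDerivAt.comp_hasDerivAt t hx
    have h3 := hasDerivAt_dot h2 h2
    rw [dotProduct_comm (D w), ← two_mul] at h3
    exact (hasDerivAt_quad hΘ h1).add (h3.const_mul _)
  have hneg : ∀ t x, t₀ ≤ t →
      (p x - v t) ⬝ᵥ Θ *ᵥ (p x - v t) + 2 * B / κ * (D x ⬝ᵥ D x) = cW →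
      2 * ((p x - v t) ⬝ᵥ Θ *ᵥ (p (f t x + k • Cp x) - p (f t (q (v t)))))
          + 2 * B / κ * (2 * (D x ⬝ᵥ D (f t x + k • Cp x))) < 0 := by
    intro t x ht h
    obtain ⟨hb1, hb2⟩ := hball t x ht h.le
    have h1 := hV t x hb1 hb2
    have h2 := mul_le_mul_of_nonneg_left (hU t x hb1) hBκ.le
    have h3 : 2 * B / κ * (-κ * (D x ⬝ᵥ D x) + M / κ)
        = - 2 * B * (D x ⬝ᵥ D x) + 2 * B / κ * (M / κ) := by field_simp
    have h4 : a * (2 * B / κ) * (D x ⬝ᵥ D x) ≤ B * (D x ⬝ᵥ D x) := by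
      refine mul_le_mul_of_nonneg_right ?_ (dot_self_nonneg' _)
      rw [mul_div_assoc', div_le_iff₀ hκpos]
      have := mul_le_mul_of_nonneg_left hκa hBpos.le
      linarith
    have h5 : M / κ < a * (u0 + 1) := by
      rw [div_lt_iff₀ hκpos]
      have := mul_nonneg (mul_nonneg hapos.le hκpos.le) hu0n
      linarith
    have h6 := mul_lt_mul_of_pos_left h5 hBκ
    have h7 : a * cW = 2 * B / κ * (a * (u0 + 1)) := by rw [hcW]; ring
    have h8 : a * ((p x - v t) ⬝ᵥ Θ *ᵥ (p x - v t)) + a * (2 * B / κ) * (D x ⬝ᵥ D x)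
        = a * cW := by rw [← h]; ring
    linarith
  have hinit : (p x₀ - v t₀) ⬝ᵥ Θ *ᵥ (p x₀ - v t₀) + 2 * B / κ * (D x₀ ⬝ᵥ D x₀) ≤ cW := by
    rw [hv0, sub_self, zero_dotProduct, zero_add, hcW]
    refine mul_le_mul_of_nonneg_left ?_ hBκ.le
    have h1 := dot_le_norm_sq (D x₀)
    have h2 : ‖D x₀‖ ≤ ‖D‖ * R₀ := (D.le_opNorm _).trans (by gcongr)
    have h3 : (Fintype.card ι : ℝ) * ‖D x₀‖ ^ 2 ≤ u0 := by rw [hu0]; gcongr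
    linarith
  obtain ⟨x, hx0, hx⟩ := lyap_exists (fun t x => f t x + k • Cp x) hfk t₀ x₀ R₃ cW
    (fun t x => (p x - v t) ⬝ᵥ Θ *ᵥ (p x - v t) + 2 * B / κ * (D x ⬝ᵥ D x))
    (fun t x w => 2 * ((p x - v t) ⬝ᵥ Θ *ᵥ (p w - p (f t (q (v t)))))
          + 2 * B / κ * (2 * (D x ⬝ᵥ D w)))
    hder (fun t x ht h => (hball t x ht h).1) hneg hinit
  refine ⟨x, v, hx0, hv0, fun t ht => (hx t ht).1, fun t ht => (hv t ht).1, ?_⟩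
  obtain ⟨T, hT0, hT⟩ := decay_lemma (u := fun t => D (x t) ⬝ᵥ D (x t))
    (u' := fun t => 2 * (D (x t) ⬝ᵥ D (f t (x t) + k • Cp (x t)))) (t₀ := t₀) (b := M / κ) hκpos
    (fun t ht => by
      have h2 : HasDerivAt (fun τ => D (x τ)) (D (f t (x t) + k • Cp (x t))) t :=
        D.hasFDerivAt.comp_hasDerivAt t (hx t ht).1
      have h3 := hasDerivAt_dot h2 h2
      rwa [dotProduct_comm (D (f t (x t) + k • Cp (x t))), ← two_mul] at h3)
    (fun t ht => hU t _ (hball t _ ht (hx t ht).2).1) (ε := η ^ 2 / 8) (by positivity)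
  refine ⟨T, fun t ht => ?_⟩
  have ht0 : t₀ ≤ t := hT0.trans ht
  have h1 := hT t ht
  obtain ⟨h2, -⟩ := htube t _ (hx t ht0).2
  have h3 : M / κ / κ ≤ M / κ := div_le_self (by positivity) hκ1.le
  have h4 : ‖D (x t)‖ ≤ η / 2 := by
    refine le_of_sq_le_sq' ?_ (by positivity)
    have := norm_sq_le_dot (D (x t))
    linarith
  have h5 : ‖q‖ * ‖p (x t) - v t‖ ≤ η / 2 := by
    refine le_of_sq_le_sq' ?_ (by positivity)
    have h6 := norm_sq_le_dot (p (x t) - v t)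
    have h7 := (hlu (p (x t) - v t)).1
    have h8 : l * ‖p (x t) - v t‖ ^ 2 ≤ σ :=
      ((mul_le_mul_of_nonneg_left h6 hl.le).trans h7).trans (h2.trans hcWσ)
    rw [hσ, le_div_iff₀ (by positivity)] at h8
    have h9 : l * (‖p (x t) - v t‖ ^ 2 * (‖q‖ + 1) ^ 2) ≤ l * (η / 2) ^ 2 := by linarith
    have h10 := le_of_mul_le_mul_left h9 hl
    have h11 : ‖q‖ ^ 2 ≤ (‖q‖ + 1) ^ 2 := by gcongr; linarith
    calc (‖q‖ * ‖p (x t) - v t‖) ^ 2 = ‖p (x t) - v t‖ ^ 2 * ‖q‖ ^ 2 := by ring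
      _ ≤ ‖p (x t) - v t‖ ^ 2 * (‖q‖ + 1) ^ 2 := by gcongr
      _ ≤ _ := h10
  have h6 : x t - q (v t) = D (x t) + q (p (x t) - v t) := by
    rw [hDx, map_sub]; abel
  rw [h6]
  refine (norm_add_le _ _).trans ?_
  have := q.le_opNorm (p (x t) - v t)
  linarith

theorem coupling_pos {N n : ℕ} (hN : 2 ≤ N) (α : Fin N → Fin N → ℝ)
    (hsym : ∀ i j, α i j = α j i) (hnn : ∀ i j, 0 ≤ α i j)
    (hconn : LinearMap.ker (lapMat α).mulVecLin
      = Submodule.span ℝ {(fun _ => 1 : Fin N → ℝ)})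
    (Λ : Matrix (Fin n) (Fin n) ℝ) (hΛ : Λ.PosDef) (δ : Fin N → Fin n → ℝ)
    (hsum : ∑ i, δ i = 0) (hne : δ ≠ 0) :
    0 < - ∑ i, δ i ⬝ᵥ Λ *ᵥ (∑ j, α i j • (δ j - δ i)) := by
  have hquad : ∀ w : Fin n → ℝ, 0 ≤ w ⬝ᵥ Λ *ᵥ w := fun w => by
    simpa using hΛ.posSemidef.dotProduct_mulVec_nonneg w
  have h1 : - ∑ i, δ i ⬝ᵥ Λ *ᵥ (∑ j, α i j • (δ j - δ i))
      = ∑ i, ∑ j, α i j * (δ i ⬝ᵥ Λ *ᵥ (δ i - δ j)) := by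
    rw [← Finset.sum_neg_distrib]
    refine Finset.sum_congr rfl fun i _ => ?_
    rw [Matrix.mulVec_sum, dotProduct_sum, ← Finset.sum_neg_distrib]
    refine Finset.sum_congr rfl fun j _ => ?_
    rw [Matrix.mulVec_smul, dotProduct_smul, smul_eq_mul, Matrix.mulVec_sub, Matrix.mulVec_sub,
      dotProduct_sub, dotProduct_sub]
    ring
  have h2 : ∑ i, ∑ j, α i j * (δ i ⬝ᵥ Λ *ᵥ (δ i - δ j))
      = ∑ i, ∑ j, α i j * (δ j ⬝ᵥ Λ *ᵥ (δ j - δ i)) := by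
    rw [Finset.sum_comm]
    refine Finset.sum_congr rfl fun i _ => Finset.sum_congr rfl fun j _ => ?_
    rw [hsym]
  have h3 : 2 * ∑ i, ∑ j, α i j * (δ i ⬝ᵥ Λ *ᵥ (δ i - δ j))
      = ∑ i, ∑ j, α i j * ((δ i - δ j) ⬝ᵥ Λ *ᵥ (δ i - δ j)) := by
    rw [two_mul]
    nth_rewrite 2 [h2]
    rw [← Finset.sum_add_distrib]
    refine Finset.sum_congr rfl fun i _ => ?_
    rw [← Finset.sum_add_distrib]
    refine Finset.sum_congr rfl fun j _ => ?_
    simp only [Matrix.mulVec_sub, dotProduct_sub, sub_dotProduct]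
    ring
  have hterm : ∀ i j, 0 ≤ α i j * ((δ i - δ j) ⬝ᵥ Λ *ᵥ (δ i - δ j)) := fun i j =>
    mul_nonneg (hnn i j) (hquad _)
  have hnonneg : 0 ≤ ∑ i, ∑ j, α i j * ((δ i - δ j) ⬝ᵥ Λ *ᵥ (δ i - δ j)) :=
    Finset.sum_nonneg fun i _ => Finset.sum_nonneg fun j _ => hterm i j
  rw [h1]
  by_contra hcon
  have hz : ∑ i, ∑ j, α i j * ((δ i - δ j) ⬝ᵥ Λ *ᵥ (δ i - δ j)) = 0 := by
    linarith
  have hz2 : ∀ i j, α i j * ((δ i - δ j) ⬝ᵥ Λ *ᵥ (δ i - δ j)) = 0 := by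
    intro i j
    have h4 := (Finset.sum_eq_zero_iff_of_nonneg
      (fun i _ => Finset.sum_nonneg fun j _ => hterm i j)).1 hz i (Finset.mem_univ i)
    exact (Finset.sum_eq_zero_iff_of_nonneg (fun j _ => hterm i j)).1 h4 j (Finset.mem_univ j)
  have hz3 : ∀ i j a, α i j * (δ i a - δ j a) = 0 := by
    intro i j a
    rcases mul_eq_zero.1 (hz2 i j) with h4 | h4
    · rw [h4, zero_mul]
    · have h5 : δ i - δ j = 0 := by
        by_contra h6
        have := hΛ.dotProduct_mulVec_pos h6
        rw [star_trivial] at this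
        linarith
      have h6 := congrFun h5 a
      simp only [Pi.sub_apply, Pi.zero_apply] at h6
      rw [h6, mul_zero]
  apply hne
  funext i a
  have hmem : (fun i => δ i a) ∈ LinearMap.ker (lapMat α).mulVecLin := by
    rw [LinearMap.mem_ker]
    funext i
    simp only [Matrix.mulVecLin_apply, mulVec, dotProduct, lapMat, Matrix.of_apply, Pi.zero_apply,
      sub_mul, ite_mul, zero_mul, Finset.sum_sub_distrib, Finset.sum_ite_eq, Finset.mem_univ,
      if_true]
    rw [Finset.sum_mul, ← Finset.sum_sub_distrib]
    refine Finset.sum_eq_zero fun j _ => ?_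
    rw [← mul_sub]
    exact hz3 i j a
  rw [hconn, Submodule.mem_span_singleton] at hmem
  obtain ⟨r, hr⟩ := hmem
  have hr' : ∀ i, δ i a = r := fun i => by simpa using (congrFun hr i).symm
  have h7 := congrFun hsum a
  simp only [Finset.sum_apply, hr', Finset.sum_const, Finset.card_univ, Fintype.card_fin,
    nsmul_eq_mul, Pi.zero_apply] at h7
  have hN0 : (N : ℝ) ≠ 0 := by
    have : N ≠ 0 := by omega
    exact_mod_cast this
  rw [hr']
  simpa [hN0] using h7

theorem coupling_bound {N n : ℕ} (hN : 2 ≤ N) (α : Fin N → Fin N → ℝ)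
    (hsym : ∀ i j, α i j = α j i) (hnn : ∀ i j, 0 ≤ α i j)
    (hconn : LinearMap.ker (lapMat α).mulVecLin
      = Submodule.span ℝ {(fun _ => 1 : Fin N → ℝ)})
    (Λ : Matrix (Fin n) (Fin n) ℝ) (hΛ : Λ.PosDef) :
    ∃ c > 0, ∀ δ : Fin N → Fin n → ℝ, ∑ i, δ i = 0 →
      ∑ i, δ i ⬝ᵥ Λ *ᵥ (∑ j, α i j • (δ j - δ i)) ≤ -c * ∑ i, δ i ⬝ᵥ δ i := by
  let sm : (Fin N → Fin n → ℝ) →ₗ[ℝ] (Fin n → ℝ) := ∑ i, LinearMap.proj i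
  have hsm : ∀ δ : Fin N → Fin n → ℝ, sm δ = ∑ i, δ i := fun δ => by
    simp [sm]
  obtain ⟨c, hc, h⟩ := quad_compare (LinearMap.ker sm)
    (fun δ : Fin N → Fin n → ℝ => ∑ i, δ i ⬝ᵥ δ i)
    (fun δ : Fin N → Fin n → ℝ => - ∑ i, δ i ⬝ᵥ Λ *ᵥ (∑ j, α i j • (δ j - δ i)))
    (by unfold dotProduct; fun_prop)
    (by
      simp only [dotProduct, mulVec, Finset.sum_apply, Pi.smul_apply, Pi.sub_apply, smul_eq_mul]
      fun_prop)
    (by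
      intro r δ
      rw [Finset.mul_sum]
      refine Finset.sum_congr rfl fun i _ => ?_
      simp only [Pi.smul_apply, smul_dotProduct, dotProduct_smul, smul_eq_mul]
      ring)
    (by
      intro r δ
      rw [mul_neg, Finset.mul_sum]
      refine congrArg _ (Finset.sum_congr rfl fun i _ => ?_)
      have : ∑ j, α i j • ((r • δ) j - (r • δ) i) = r • ∑ j, α i j • (δ j - δ i) := by
        rw [Finset.smul_sum]
        refine Finset.sum_congr rfl fun j _ => ?_
        rw [Pi.smul_apply, Pi.smul_apply, ← smul_sub, smul_comm]
      rw [this, Matrix.mulVec_smul, dotProduct_smul, Pi.smul_apply, smul_dotProduct]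
      simp only [smul_eq_mul]
      ring)
    (fun δ hδ hne => coupling_pos hN α hsym hnn hconn Λ hΛ δ
      (by rw [← hsm]; exact hδ) hne)
  refine ⟨c, hc, fun δ hδ => ?_⟩
  have := h δ (by rw [LinearMap.mem_ker, hsm, hδ])
  linarith

theorem eunorm_le {ι : Type*} [Fintype ι] (v : ι → ℝ) {r : ℝ} (hr : 0 ≤ r) (h : ‖v‖ ≤ r) :
    eunorm v ≤ (Fintype.card ι + 1) * r := by
  unfold eunorm
  apply Real.sqrt_le_iff.2
  refine ⟨by positivity, ?_⟩
  have h1 := dot_le_norm_sq v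
  have h2 : v ⬝ᵥ v = ∑ j, v j ^ 2 := by simp [dotProduct, sq]
  rw [← h2]
  have h3 : (Fintype.card ι : ℝ) * ‖v‖ ^ 2 ≤ Fintype.card ι * r ^ 2 := by gcongr
  have h4 : (0 : ℝ) ≤ Fintype.card ι := by positivity
  nlinarith [mul_nonneg h4 (sq_nonneg r), mul_nonneg (mul_nonneg h4 h4) (sq_nonneg r), sq_nonneg r]

section Network

variable {N n : ℕ} {m : Fin N → ℕ}

/-- Network state index. -/
abbrev NIdx (N n : ℕ) (m : Fin N → ℕ) := (Σ i : Fin N, Fin (m i)) ⊕ (Fin N × Fin n)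

/-- Blended state index. -/
abbrev BIdx (N n : ℕ) (m : Fin N → ℕ) := (Σ i : Fin N, Fin (m i)) ⊕ Fin n

/-- The `i`-th internal state. -/
def zc (m : Fin N → ℕ) (n : ℕ) (i : Fin N) : (NIdx N n m → ℝ) →L[ℝ] (Fin (m i) → ℝ) :=
  ContinuousLinearMap.pi fun b => ContinuousLinearMap.proj (Sum.inl ⟨i, b⟩)

/-- The `i`-th output. -/
def yc (m : Fin N → ℕ) (n : ℕ) (i : Fin N) : (NIdx N n m → ℝ) →L[ℝ] (Fin n → ℝ) :=
  ContinuousLinearMap.pi fun b => ContinuousLinearMap.proj (Sum.inr (i, b))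

/-- Uncoupled network field. -/
def netF (g : (i : Fin N) → ℝ → (Fin (m i) → ℝ) → (Fin n → ℝ) → Fin (m i) → ℝ)
    (h : (i : Fin N) → ℝ → (Fin n → ℝ) → (Fin (m i) → ℝ) → Fin n → ℝ)
    (t : ℝ) (x : NIdx N n m → ℝ) (a : NIdx N n m) : ℝ :=
  Sum.elim
    (fun q : Σ i : Fin N, Fin (m i) => g q.1 t (zc m n q.1 x) (yc m n q.1 x) q.2)
    (fun r : Fin N × Fin n => h r.1 t (yc m n r.1 x) (zc m n r.1 x) r.2) a

theorem netF_good {g : (i : Fin N) → ℝ → (Fin (m i) → ℝ) → (Fin n → ℝ) → Fin (m i) → ℝ}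
    {h : (i : Fin N) → ℝ → (Fin n → ℝ) → (Fin (m i) → ℝ) → Fin n → ℝ}
    (hg : ∀ i, Reg2 (g i)) (hh : ∀ i, Reg2 (h i)) : GoodF (netF g h) := by
  refine GoodF.pi (f := fun a t x => netF g h t x a) fun a => ?_
  rcases a with q | r
  · exact ((hg q.1).good.comp_clm ((zc m n q.1).prod (yc m n q.1))).clm_comp
      (ContinuousLinearMap.proj q.2)
  · exact ((hh r.1).good.comp_clm ((yc m n r.1).prod (zc m n r.1))).clm_comp
      (ContinuousLinearMap.proj r.2)

/-- Diffusive coupling. -/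
noncomputable def netC (m : Fin N → ℕ) (α : Fin N → Fin N → ℝ) (Λ : Matrix (Fin n) (Fin n) ℝ) :
    (NIdx N n m → ℝ) →L[ℝ] (NIdx N n m → ℝ) :=
  ContinuousLinearMap.pi fun a => Sum.rec (motive := fun _ => (NIdx N n m → ℝ) →L[ℝ] ℝ)
    (fun _ => 0)
    (fun r => (ContinuousLinearMap.proj r.2).comp
      ((LinearMap.toContinuousLinearMap Λ.mulVecLin).comp
        (∑ j, α r.1 j • (yc m n j - yc m n r.1)))) a

theorem netC_inl (α : Fin N → Fin N → ℝ) (Λ : Matrix (Fin n) (Fin n) ℝ) (x : NIdx N n m → ℝ)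
    (q : Σ i : Fin N, Fin (m i)) : netC m α Λ x (Sum.inl q) = 0 := rfl

theorem netC_inr (α : Fin N → Fin N → ℝ) (Λ : Matrix (Fin n) (Fin n) ℝ) (x : NIdx N n m → ℝ)
    (r : Fin N × Fin n) : netC m α Λ x (Sum.inr r)
      = (Λ *ᵥ (∑ j, α r.1 j • (yc m n j x - yc m n r.1 x))) r.2 := by
  have : (∑ j, α r.1 j • (yc m n j - yc m n r.1)) x
      = ∑ j, α r.1 j • (yc m n j x - yc m n r.1 x) := by
    simp [ContinuousLinearMap.sum_apply]
  rw [← this]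
  rfl

/-- Averaging. -/
noncomputable def avgP (N n : ℕ) (m : Fin N → ℕ) : (NIdx N n m → ℝ) →L[ℝ] (BIdx N n m → ℝ) :=
  ContinuousLinearMap.pi fun a => Sum.rec (motive := fun _ => (NIdx N n m → ℝ) →L[ℝ] ℝ)
    (fun q => ContinuousLinearMap.proj (Sum.inl q))
    (fun j => (N : ℝ)⁻¹ • ∑ i, ContinuousLinearMap.proj (Sum.inr (i, j))) a

theorem avgP_inl (x : NIdx N n m → ℝ) (q : Σ i : Fin N, Fin (m i)) :
    avgP N n m x (Sum.inl q) = x (Sum.inl q) := rfl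

theorem avgP_inr (x : NIdx N n m → ℝ) (j : Fin n) :
    avgP N n m x (Sum.inr j) = (N : ℝ)⁻¹ * ∑ i, x (Sum.inr (i, j)) := by
  have : ((N : ℝ)⁻¹ • ∑ i, (ContinuousLinearMap.proj (Sum.inr (i, j)) :
      (NIdx N n m → ℝ) →L[ℝ] ℝ)) x = (N : ℝ)⁻¹ * ∑ i, x (Sum.inr (i, j)) := by
    simp [ContinuousLinearMap.sum_apply]
  rw [← this]
  rfl

/-- Embedding of the synchronized states. -/
def embQ (N n : ℕ) (m : Fin N → ℕ) : (BIdx N n m → ℝ) →L[ℝ] (NIdx N n m → ℝ) :=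
  ContinuousLinearMap.pi fun a => Sum.rec (motive := fun _ => (BIdx N n m → ℝ) →L[ℝ] ℝ)
    (fun q => ContinuousLinearMap.proj (Sum.inl q))
    (fun r => ContinuousLinearMap.proj (Sum.inr r.2)) a

theorem embQ_inl (x : BIdx N n m → ℝ) (q : Σ i : Fin N, Fin (m i)) :
    embQ N n m x (Sum.inl q) = x (Sum.inl q) := rfl

theorem embQ_inr (x : BIdx N n m → ℝ) (r : Fin N × Fin n) :
    embQ N n m x (Sum.inr r) = x (Sum.inr r.2) := rfl

theorem blend_eq (g : (i : Fin N) → ℝ → (Fin (m i) → ℝ) → (Fin n → ℝ) → Fin (m i) → ℝ)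
    (h : (i : Fin N) → ℝ → (Fin n → ℝ) → (Fin (m i) → ℝ) → Fin n → ℝ) :
    (fun t v => avgP N n m (netF g h t (embQ N n m v))) = blendField g h := by
  funext t v a
  rcases a with q | j
  · rfl
  · rw [avgP_inr]
    simp only [blendField, Sum.elim_inr, Pi.smul_apply, Finset.sum_apply, smul_eq_mul]
    rfl

theorem avg_netC (α : Fin N → Fin N → ℝ) (hsym : ∀ i j, α i j = α j i)
    (Λ : Matrix (Fin n) (Fin n) ℝ) (x : NIdx N n m → ℝ) : avgP N n m (netC m α Λ x) = 0 := by
  funext a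
  rcases a with q | j
  · rfl
  · rw [avgP_inr]
    simp only [netC_inr]
    rw [← Finset.sum_apply, ← Matrix.mulVec_sum]
    have h0 : ∑ i, ∑ l, α i l • (yc m n l x - yc m n i x) = 0 := by
      have h1 : ∑ i, ∑ l, α i l • (yc m n l x - yc m n i x)
          = - ∑ i, ∑ l, α i l • (yc m n l x - yc m n i x) := by
        rw [← Finset.sum_neg_distrib, Finset.sum_comm]
        refine Finset.sum_congr rfl fun i _ => ?_
        rw [← Finset.sum_neg_distrib]
        refine Finset.sum_congr rfl fun l _ => ?_
        rw [hsym, ← smul_neg, neg_sub]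
      exact self_eq_neg.1 h1
    rw [h0]
    simp

theorem net_diss (hN : 2 ≤ N) (α : Fin N → Fin N → ℝ) (Λ : Matrix (Fin n) (Fin n) ℝ) (c : ℝ)
    (hc : ∀ δ : Fin N → Fin n → ℝ, ∑ i, δ i = 0 →
      ∑ i, δ i ⬝ᵥ Λ *ᵥ (∑ j, α i j • (δ j - δ i)) ≤ -c * ∑ i, δ i ⬝ᵥ δ i)
    (x : NIdx N n m → ℝ) :
    (x - embQ N n m (avgP N n m x)) ⬝ᵥ netC m α Λ x
      ≤ -c * ((x - embQ N n m (avgP N n m x)) ⬝ᵥ (x - embQ N n m (avgP N n m x))) := by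
  have hN0 : (N : ℝ) ≠ 0 := by
    have : N ≠ 0 := by omega
    exact_mod_cast this
  set d := x - embQ N n m (avgP N n m x) with hd
  let δ : Fin N → Fin n → ℝ := fun i j => d (Sum.inr (i, j))
  have hδ : ∀ i j, δ i j = x (Sum.inr (i, j)) - (N : ℝ)⁻¹ * ∑ l, x (Sum.inr (l, j)) := by
    intro i j
    simp only [δ, hd, Pi.sub_apply, embQ_inr, avgP_inr]
  have hdl : ∀ q, d (Sum.inl q) = 0 := fun q => by
    simp only [hd, Pi.sub_apply, embQ_inl, avgP_inl, sub_self]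
  have hsum : ∑ i, δ i = 0 := by
    funext j
    simp only [Finset.sum_apply, hδ, Finset.sum_sub_distrib, Finset.sum_const, Finset.card_univ,
      Fintype.card_fin, nsmul_eq_mul, Pi.zero_apply]
    field_simp
    ring
  have hdiff : ∀ i j, yc m n j x - yc m n i x = δ j - δ i := by
    intro i j
    funext a
    rw [Pi.sub_apply, Pi.sub_apply, hδ, hδ]
    show x (Sum.inr (j, a)) - x (Sum.inr (i, a)) = _
    ring
  have h1 : d ⬝ᵥ netC m α Λ x = ∑ i, δ i ⬝ᵥ Λ *ᵥ (∑ j, α i j • (δ j - δ i)) := by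
    simp only [dotProduct, Fintype.sum_sum_type, hdl, zero_mul, Finset.sum_const_zero, zero_add,
      Fintype.sum_prod_type, netC_inr, hdiff]
    rfl
  have h2 : d ⬝ᵥ d = ∑ i, δ i ⬝ᵥ δ i := by
    simp only [dotProduct, Fintype.sum_sum_type, hdl, zero_mul, Finset.sum_const_zero, zero_add,
      Fintype.sum_prod_type]
    rfl
  rw [h1, h2]
  exact hc δ hsum

end Network

theorem stmt3
    {N n : ℕ} (hN : 2 ≤ N) (m : Fin N → ℕ) (t₀ : ℝ)
    (α : Fin N → Fin N → ℝ)
    (hsym : ∀ i j, α i j = α j i) (hnn : ∀ i j, 0 ≤ α i j) (hdiag : ∀ i, α i i = 0)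
    (hpsd : (lapMat α).PosSemidef)
    (hconn : LinearMap.ker (lapMat α).mulVecLin
      = Submodule.span ℝ {(fun _ => 1 : Fin N → ℝ)})
    (Λ : Matrix (Fin n) (Fin n) ℝ) (hΛ : Λ.IsSymm ∧ Λ.PosDef)
    (g : (i : Fin N) → ℝ → (Fin (m i) → ℝ) → (Fin n → ℝ) → Fin (m i) → ℝ)
    (h : (i : Fin N) → ℝ → (Fin n → ℝ) → (Fin (m i) → ℝ) → Fin n → ℝ)
    (hgreg : ∀ i, Reg2 (g i)) (hhreg : ∀ i, Reg2 (h i))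
    (hcontr : Contractive (blendField g h))
    (K : Set ((i : Fin N) → (Fin (m i) → ℝ) × (Fin n → ℝ))) (hK : IsCompact K)
    (η : ℝ) (hη : 0 < η) :
    ∃ kstar > (0:ℝ), ∀ k > kstar, ∀ P₀ ∈ K,
      ∃ (z : (i : Fin N) → ℝ → Fin (m i) → ℝ) (y : Fin N → ℝ → Fin n → ℝ)
        (zh : (i : Fin N) → ℝ → Fin (m i) → ℝ) (s : ℝ → Fin n → ℝ),
        (∀ i, z i t₀ = (P₀ i).1 ∧ y i t₀ = (P₀ i).2) ∧
        (∀ i, ∀ t ≥ t₀,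
          HasDerivAt (z i) (g i t (z i t) (y i t)) t ∧
          HasDerivAt (y i)
            (h i t (y i t) (z i t) + k • Λ.mulVec (∑ j, α i j • (y j t - y i t))) t) ∧
        (∀ i, zh i t₀ = (P₀ i).1) ∧ s t₀ = (N : ℝ)⁻¹ • ∑ i, (P₀ i).2 ∧
        (∀ i, ∀ t ≥ t₀, HasDerivAt (zh i) (g i t (zh i t) (s t)) t) ∧
        (∀ t ≥ t₀, HasDerivAt s ((N : ℝ)⁻¹ • ∑ i, h i t (s t) (zh i t)) t) ∧
        (∀ i, LimsupLE (fun t => eunorm (z i t - zh i t)) η ∧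
              LimsupLE (fun t => eunorm (y i t - s t)) η) := by
  classical
  obtain ⟨c, hc, hcb⟩ := coupling_bound hN α hsym hnn hconn Λ hΛ.2
  -- a bound for the initial states
  let flat : ((i : Fin N) → (Fin (m i) → ℝ) × (Fin n → ℝ)) → (NIdx N n m → ℝ) := fun P a =>
    Sum.elim (fun q : Σ i : Fin N, Fin (m i) => (P q.1).1 q.2)
      (fun r : Fin N × Fin n => (P r.1).2 r.2) a
  have hflat : Continuous flat := by
    refine continuous_pi fun a => ?_
    rcases a with q | r
    · exact (continuous_apply q.2).comp (continuous_fst.comp (continuous_apply q.1))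
    · exact (continuous_apply r.2).comp (continuous_snd.comp (continuous_apply r.1))
  obtain ⟨R₀, hR₀⟩ := (hK.image hflat).isBounded.exists_norm_le
  let η' : ℝ := η / (∑ i, ((m i : ℝ) + 1) + ((n : ℝ) + 1))
  have hden : 0 < ∑ i, ((m i : ℝ) + 1) + ((n : ℝ) + 1) := by positivity
  have hη' : 0 < η' := div_pos hη hden
  have hηeq : (∑ i, ((m i : ℝ) + 1) + ((n : ℝ) + 1)) * η' = η := mul_div_cancel₀ _ hden.ne'
  obtain ⟨ks, hks, H⟩ := abstract_sync (netF g h) (netF_good hgreg hhreg) (netC m α Λ)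
    (avgP N n m) (embQ N n m) (avg_netC α hsym Λ) c hc (net_diss hN α Λ c hcb)
    (by rw [blend_eq]; convert hcontr) t₀ R₀ η' hη'
  refine ⟨ks, hks, fun k hk P₀ hP₀ => ?_⟩
  obtain ⟨x, v, hx0, hv0, hx, hv, T, hT⟩ := H k hk (flat P₀) (hR₀ _ ⟨P₀, hP₀, rfl⟩)
  have hbl : ∀ t w, avgP N n m (netF g h t (embQ N n m w)) = blendField g h t w := fun t w =>
    congrFun (congrFun (blend_eq g h) t) w
  refine ⟨fun i t b => x t (Sum.inl ⟨i, b⟩), fun i t j => x t (Sum.inr (i, j)),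
    fun i t b => v t (Sum.inl ⟨i, b⟩), fun t j => v t (Sum.inr j), ?_, ?_, ?_, ?_, ?_, ?_, ?_⟩
  · intro i
    simp only [hx0]
    exact ⟨rfl, rfl⟩
  · intro i t ht
    have h1 := hasDerivAt_pi.1 (hx t ht)
    refine ⟨hasDerivAt_pi.2 fun b => ?_, hasDerivAt_pi.2 fun j => ?_⟩
    · have h2 := h1 (Sum.inl ⟨i, b⟩)
      rw [Pi.add_apply, Pi.smul_apply, netC_inl, smul_zero, add_zero] at h2
      exact h2
    · have h2 := h1 (Sum.inr (i, j))
      rw [Pi.add_apply, Pi.smul_apply, netC_inr] at h2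
      exact h2
  · intro i
    simp only [hv0]
    rfl
  · funext j
    simp only [hv0, avgP_inr, Pi.smul_apply, Finset.sum_apply, smul_eq_mul]
    rfl
  · intro i t ht
    have h1 := hasDerivAt_pi.1 (hv t ht)
    refine hasDerivAt_pi.2 fun b => ?_
    have h2 := h1 (Sum.inl ⟨i, b⟩)
    rw [hbl] at h2
    exact h2
  · intro t ht
    have h1 := hasDerivAt_pi.1 (hv t ht)
    refine hasDerivAt_pi.2 fun j => ?_
    have h2 := h1 (Sum.inr j)
    rw [hbl] at h2
    exact h2
  · have hcomp : ∀ t, T ≤ t → ∀ a, ‖x t a - embQ N n m (v t) a‖ ≤ η' := fun t ht a =>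
      (norm_le_pi_norm (x t - embQ N n m (v t)) a).trans (hT t ht)
    have hm0 : ∀ i, 0 ≤ (m i : ℝ) + 1 := fun i => by positivity
    have hn0 : 0 ≤ (n : ℝ) + 1 := by positivity
    intro i
    have hmi : (m i : ℝ) + 1 ≤ ∑ i, ((m i : ℝ) + 1) :=
      Finset.single_le_sum (f := fun i => (m i : ℝ) + 1) (fun i _ => hm0 i) (Finset.mem_univ i)
    refine ⟨fun ε hε => ⟨T, fun t ht => ?_⟩, fun ε hε => ⟨T, fun t ht => ?_⟩⟩
    · have h1 := eunorm_le ((fun b => x t (Sum.inl ⟨i, b⟩)) - fun b => v t (Sum.inl ⟨i, b⟩))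
        hη'.le ((pi_norm_le_iff_of_nonneg hη'.le).2 fun b => hcomp t ht (Sum.inl ⟨i, b⟩))
      rw [Fintype.card_fin] at h1
      have h2 : ((m i : ℝ) + 1) * η' ≤ η := by
        rw [← hηeq]
        exact mul_le_mul_of_nonneg_right (by linarith) hη'.le
      linarith
    · have h1 := eunorm_le ((fun j => x t (Sum.inr (i, j))) - fun j => v t (Sum.inr j))
        hη'.le ((pi_norm_le_iff_of_nonneg hη'.le).2 fun j => hcomp t ht (Sum.inr (i, j)))
      rw [Fintype.card_fin] at h1
      have h2 : ((n : ℝ) + 1) * η' ≤ η := by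
        rw [← hηeq]
        exact mul_le_mul_of_nonneg_right (by linarith [hm0 i]) hη'.le
      linarith
end
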